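/- arXiv:0704.2411 — 3 statements merged into one kernel-verified Lean document; each statement's English description precedes it below -/
import Mathlib

section
/- Let K be an infinite field with char(K) = 2 and let h be a closed path in a quiver Q with h ≢ 0. Then there exist pairwise different primitive closed paths b_1,…,b_r, c_1,…,c_t in Q (r, t ≥ 0) such that mdeg(h) = Σ_{i=1}^r mdeg(b_i) + 2 Σ_{k=1}^t mdeg(c_k), and there exist pairwise different arrows x_1,…,x_r, y_1,…,y_t, z_1,…,z_t of Q such that for all 1 ≤ i ≤ r and 1 ≤ j ≤ t: y_j and z_j occur in c_j with deg_{y_j}(h) = deg_{z_j}(h) = 2, and x_i occurs in b_i with deg_{x_i}(h) − 2 Σ_{k=1}^t deg_{x_i}(c_k) = 1. -/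
open Classical BigOperators

/-- A quiver (finite oriented graph data): a type of vertices, a type of arrows,
and source (tail `a''`) and target (head `a'`) maps. -/
structure QuiverData where
  V : Type
  A : Type
  src : A → V
  tgt : A → V

namespace QuiverData

variable (Q : QuiverData)

/-- `Q.IsPathFrom u v l` : the list of arrows `l` is a (possibly empty) path
from `u` to `v`, i.e. `l = [a₁, …, a_s]` with `a₁'' = u`, `aᵢ' = a_{i+1}''`, `a_s' = v`. -/
def IsPathFrom : Q.V → Q.V → List Q.A → Prop
  | u, v, [] => u = v
  | u, v, a :: l => Q.src a = u ∧ IsPathFrom (Q.tgt a) v l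

/-- A (non-empty) closed path in the vertex `v`. -/
def IsClosedAt (v : Q.V) (l : List Q.A) : Prop :=
  l ≠ [] ∧ Q.IsPathFrom v v l

/-- A (non-empty) closed path. -/
def IsClosed (l : List Q.A) : Prop := ∃ v, Q.IsClosedAt v l

/-- `deg_w(l)`: the degree of the closed path `l` in the vertex `w`,
i.e. the number of `i` with `aᵢ' = w`. -/
noncomputable def vdeg (l : List Q.A) (w : Q.V) : ℕ :=
  Nat.card {i : Fin l.length // Q.tgt (l.get i) = w}

/-- `deg_b(l)`: the number of occurrences of the arrow `b` in the path `l`. -/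
noncomputable def adeg (l : List Q.A) (b : Q.A) : ℕ :=
  Nat.card {i : Fin l.length // l.get i = b}

/-- The number of occurrences in `l` of arrows from the set `S`. -/
noncomputable def sdeg (l : List Q.A) (S : Set Q.A) : ℕ :=
  Nat.card {i : Fin l.length // l.get i ∈ S}

/-- A primitive closed path in `v`: a closed path without self-intersections,
i.e. `deg_w = 1` for every vertex `w` of the path. -/
def IsPrimitiveAt (v : Q.V) (l : List Q.A) : Prop :=
  Q.IsClosedAt v l ∧ ∀ a ∈ l, Q.vdeg l (Q.tgt a) = 1

/-- A primitive closed path. -/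
def IsPrimitive (l : List Q.A) : Prop := ∃ v, Q.IsPrimitiveAt v l

/-- `m(Q) = m` : `m` is the maximal degree of primitive closed paths in `Q`. -/
def MaxPrimDeg (m : ℕ) : Prop :=
  (∃ l, Q.IsPrimitive l ∧ l.length = m) ∧ ∀ l, Q.IsPrimitive l → l.length ≤ m

/-- `Q` is strongly connected: there is a closed path containing all vertices;
a quiver with one vertex and no arrows is also strongly connected. -/
def StronglyConnected : Prop :=
  (∃ v l, Q.IsClosedAt v l ∧ ∀ w, ∃ a ∈ l, Q.tgt a = w) ∨
    (Subsingleton Q.V ∧ IsEmpty Q.A)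

/-- Formal negation on the set (closed paths with a formal sign) ∪ {0};
`none` is the symbol `0`, and `some (e, l)` is `(-1)^e·l`. -/
def negO : Option (Bool × List Q.A) → Option (Bool × List Q.A)
  | none => none
  | some (e, l) => some (!e, l)

/-- The equivalence `≡` on the set of closed paths of `Q`, enlarged by an additional
symbol `0` (represented by `none`) and formal signs (`some (e, l)` is `(-1)^e·l`).
The parameter `c2` is the proposition "the characteristic of the ground field is 2"
(so that the formal sign `(-1)^σ` is trivial exactly when `c2` holds).
It is the smallest equivalence, compatible with formal negation, such that for paths
`a`, `b` with `ab` a closed path and incident closed paths `a₁, a₂, …`: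
(1) `ab ≡ ba`; (2) `a_{σ(1)}⋯a_{σ(t)} ≡ (-1)^σ a₁⋯a_t` for `t ≥ 2` and `σ ∈ S_t`
(generated here by transpositions of adjacent factors);
(3) `a₁²a₂ ≡ 0`; (4) if `c2` then `a₁² ≡ 0`, while if `¬c2` then `a₁a₂a₃a₄ ≡ 0`. -/
inductive PEquiv (c2 : Prop) : Option (Bool × List Q.A) → Option (Bool × List Q.A) → Prop
  | refl (x) : PEquiv c2 x x
  | symm {x y} : PEquiv c2 x y → PEquiv c2 y x
  | trans {x y z} : PEquiv c2 x y → PEquiv c2 y z → PEquiv c2 x z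
  | neg {x y} : PEquiv c2 x y → PEquiv c2 (Q.negO x) (Q.negO y)
  | cyc (u v : Q.V) (a b : List Q.A) (e : Bool) :
      Q.IsPathFrom u v a → Q.IsPathFrom v u b → a ++ b ≠ [] →
      PEquiv c2 (some (e, a ++ b)) (some (e, b ++ a))
  | swap (v : Q.V) (w₁ c d w₂ : List Q.A) (e : Bool) :
      Q.IsPathFrom v v w₁ → Q.IsClosedAt v c → Q.IsClosedAt v d → Q.IsPathFrom v v w₂ →
      PEquiv c2 (some (e, w₁ ++ c ++ d ++ w₂))
        (some (if c2 then e else !e, w₁ ++ d ++ c ++ w₂))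
  | sq_mul (v : Q.V) (c d : List Q.A) (e : Bool) :
      Q.IsClosedAt v c → Q.IsClosedAt v d →
      PEquiv c2 (some (e, c ++ c ++ d)) none
  | sq (v : Q.V) (c : List Q.A) (e : Bool) :
      c2 → Q.IsClosedAt v c → PEquiv c2 (some (e, c ++ c)) none
  | four (v : Q.V) (c₁ c₂ c₃ c₄ : List Q.A) (e : Bool) :
      ¬c2 → Q.IsClosedAt v c₁ → Q.IsClosedAt v c₂ → Q.IsClosedAt v c₃ → Q.IsClosedAt v c₄ →
      PEquiv c2 (some (e, c₁ ++ c₂ ++ c₃ ++ c₄)) none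
  | sign_triv (e : Bool) (l : List Q.A) :
      c2 → PEquiv c2 (some (e, l)) (some (!e, l))

/-- `l₁ ≡ l₂` for closed paths. -/
def PathEquiv (c2 : Prop) (l₁ l₂ : List Q.A) : Prop :=
  Q.PEquiv c2 (some (false, l₁)) (some (false, l₂))

/-- `l ≡ 0`. -/
def EquivZero (c2 : Prop) (l : List Q.A) : Prop :=
  Q.PEquiv c2 (some (false, l)) none

/-! ### Invariants of quivers for the dimension vector `(2,…,2)` -/

/-- Variables `x_{ij}(a)` of the polynomial ring: for each arrow `a` the entries of the
`2 × 2` generic matrix `X_a`. -/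
def Var : Type := Q.A × Fin 2 × Fin 2

variable (K : Type) [Field K]

/-- The substitution describing the base-change action of the group
`∏_{v} GL₂(K)` (given by a family of invertible matrices `g`) on the variables:
`x_{ij}(a)` is sent to the `(i,j)` entry of `g_{a'} X_a g_{a''}⁻¹`. -/
noncomputable def actVar (g : Q.V → Matrix (Fin 2) (Fin 2) K) (p : Q.Var) :
    MvPolynomial Q.Var K :=
  ∑ k : Fin 2, ∑ l : Fin 2,
    MvPolynomial.C (g (Q.tgt p.1) p.2.1 k * (g (Q.src p.1))⁻¹ l p.2.2) *
      MvPolynomial.X (p.1, k, l)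

/-- `f` belongs to the algebra of invariants `Inv(Q,(2,…,2))`. -/
def IsInvariant (f : MvPolynomial Q.Var K) : Prop :=
  ∀ g : Q.V → Matrix (Fin 2) (Fin 2) K, (∀ v, IsUnit (g v).det) →
    MvPolynomial.aeval (Q.actVar K g) f = f

/-- The space `Inv(Q,(2,…,2))⁺` of invariants without constant term (the span of the
homogeneous invariants of positive degree). -/
def PlusSet : Set (MvPolynomial Q.Var K) :=
  {f | Q.IsInvariant K f ∧ MvPolynomial.constantCoeff f = 0}

/-- `f` is decomposable: it lies in the ideal `(Inv⁺)²`, i.e. in the `K`-span of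
products of two invariants of positive degree. -/
def Decomposable (f : MvPolynomial Q.Var K) : Prop :=
  f ∈ Submodule.span K
    {x : MvPolynomial Q.Var K | ∃ p ∈ Q.PlusSet K, ∃ q ∈ Q.PlusSet K, x = p * q}

/-- The generic `2 × 2` matrix `X_a` of an arrow `a`. -/
noncomputable def genMat (a : Q.A) : Matrix (Fin 2) (Fin 2) (MvPolynomial Q.Var K) :=
  Matrix.of fun i j => MvPolynomial.X (a, i, j)

/-- For a path `l = a₁⋯a_s`, the matrix product `X_{a_s} ⋯ X_{a_1}`. -/
noncomputable def pathMat (l : List Q.A) : Matrix (Fin 2) (Fin 2) (MvPolynomial Q.Var K) :=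
  ((l.map (Q.genMat K)).reverse).prod

/-- `tr(X_{a_s} ⋯ X_{a_1})` for a path `l = a₁⋯a_s`. -/
noncomputable def pathTr (l : List Q.A) : MvPolynomial Q.Var K :=
  Matrix.trace (Q.pathMat K l)

/-- `det(X_{a_s} ⋯ X_{a_1})` for a path `l = a₁⋯a_s`. -/
noncomputable def pathDet (l : List Q.A) : MvPolynomial Q.Var K :=
  Matrix.det (Q.pathMat K l)

/-- `σ_k(X_{a_s} ⋯ X_{a_1})`, the `k`-th coefficient of the characteristic polynomial
of the `2 × 2` matrix `X_{a_s} ⋯ X_{a_1}` (which vanishes for `k > 2`). -/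
noncomputable def pathSigma (k : ℕ) (l : List Q.A) : MvPolynomial Q.Var K :=
  if k = 0 then 1 else if k = 1 then Q.pathTr K l
    else if k = 2 then Q.pathDet K l else 0

/-- `D(Q,(2,…,2))`: the maximal degree of an indecomposable homogeneous invariant,
i.e. the least upper bound for the degrees of elements of a minimal homogeneous
system of generators of `Inv(Q,(2,…,2))`. -/
noncomputable def Dnum : ℕ :=
  sSup {k | ∃ f : MvPolynomial Q.Var K,
    Q.IsInvariant K f ∧ f.IsHomogeneous k ∧ ¬ Q.Decomposable K f}

end QuiverData

/-- `max {D(Q,(2,…,2)) | Q ∈ 𝒬(n,d,m)}` where `𝒬(n,d,m)` is the set of strongly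
connected quivers with `n` vertices (vertex set `Fin n`), `d` arrows (arrow set `Fin d`)
and maximal degree of primitive closed paths equal to `m`. -/
noncomputable def QuiverData.maxD (K : Type) [Field K] (n d m : ℕ) : ℕ :=
  sSup {N | ∃ s t : Fin d → Fin n,
    (QuiverData.mk (Fin n) (Fin d) s t).StronglyConnected ∧
    (QuiverData.mk (Fin n) (Fin d) s t).MaxPrimDeg m ∧
    N = (QuiverData.mk (Fin n) (Fin d) s t).Dnum K}

namespace QuiverData

variable {Q : QuiverData}

theorem aux_card_get {α : Type} (p : α → Prop) (l : List α) :
    Nat.card {i : Fin l.length // p (l.get i)} = l.countP (fun x => decide (p x)) := by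
  rw [Nat.card_eq_fintype_card, Fintype.card_subtype]
  induction l with
  | nil => simp
  | cons a l ih =>
    rw [List.countP_cons, ← ih]
    have := Fin.card_filter_univ_succ (n := l.length) (fun i => p ((a :: l).get i))
    simp only [List.length_cons] at *
    rw [this]
    by_cases h : p a <;> simp [h]

theorem aux_adeg (l : List Q.A) (b : Q.A) : Q.adeg l b = l.count b := by
  unfold adeg
  rw [aux_card_get (fun x => x = b) l, List.count]
  congr 1

theorem aux_vdeg (l : List Q.A) (w : Q.V) : Q.vdeg l w = (l.map Q.tgt).count w := by
  unfold vdeg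
  rw [aux_card_get (fun x => Q.tgt x = w) l, List.count, List.countP_map]
  congr 1

theorem aux_prim_iff (v : Q.V) (l : List Q.A) :
    Q.IsPrimitiveAt v l ↔ Q.IsClosedAt v l ∧ (l.map Q.tgt).Nodup := by
  unfold IsPrimitiveAt
  refine and_congr_right fun _ => ?_
  rw [List.nodup_iff_count_eq_one]
  simp [aux_vdeg]

theorem aux_append (u v : Q.V) (l₁ l₂ : List Q.A) :
    Q.IsPathFrom u v (l₁ ++ l₂) ↔ ∃ w, Q.IsPathFrom u w l₁ ∧ Q.IsPathFrom w v l₂ := by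
  induction l₁ generalizing u with
  | nil => simp [IsPathFrom]
  | cons a l ih => simp [IsPathFrom, ih, and_assoc]

theorem aux_cons (u v : Q.V) (a : Q.A) (l : List Q.A) :
    Q.IsPathFrom u v (a :: l) ↔ Q.src a = u ∧ Q.IsPathFrom (Q.tgt a) v l := Iff.rfl

theorem aux_nil (u v : Q.V) : Q.IsPathFrom u v [] ↔ u = v := Iff.rfl

theorem aux_comp {u v w : Q.V} {l₁ l₂ : List Q.A} (h1 : Q.IsPathFrom u w l₁)
    (h2 : Q.IsPathFrom w v l₂) : Q.IsPathFrom u v (l₁ ++ l₂) :=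
  (aux_append _ _ _ _).2 ⟨w, h1, h2⟩

theorem aux_single (a : Q.A) : Q.IsPathFrom (Q.src a) (Q.tgt a) [a] := ⟨rfl, rfl⟩

theorem aux_cat {u v : Q.V} {l : List Q.A} (a : Q.A) (h : Q.IsPathFrom (Q.tgt a) v l)
    (hu : Q.src a = u) : Q.IsPathFrom u v (a :: l) := ⟨hu, h⟩

theorem aux_rot {c2 : Prop} {u : Q.V} {l₁ l₂ : List Q.A} (hp : Q.IsPathFrom u u (l₁ ++ l₂)) :
    Q.PathEquiv c2 (l₁ ++ l₂) (l₂ ++ l₁) := by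
  by_cases hn : l₁ ++ l₂ = []
  · simp at hn
    rw [hn.1, hn.2]; exact PEquiv.refl _
  · obtain ⟨w, h1, h2⟩ := (aux_append _ _ _ _).1 hp
    exact PEquiv.cyc u w l₁ l₂ false h1 h2 hn

theorem aux_swap {c2 : Prop} (hc : c2) {v : Q.V} {w₁ c d w₂ : List Q.A}
    (h1 : Q.IsPathFrom v v w₁) (h2 : Q.IsPathFrom v v c) (h3 : Q.IsPathFrom v v d)
    (h4 : Q.IsPathFrom v v w₂) :
    Q.PathEquiv c2 (w₁ ++ c ++ d ++ w₂) (w₁ ++ d ++ c ++ w₂) := by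
  by_cases hcn : c = []
  · subst hcn; simp; exact PEquiv.refl _
  by_cases hdn : d = []
  · subst hdn; simp; exact PEquiv.refl _
  have := PEquiv.swap (Q := Q) (c2 := c2) v w₁ c d w₂ false h1 ⟨hcn, h2⟩ ⟨hdn, h3⟩ h4
  simpa [hc, PathEquiv] using this

theorem aux_split2 {α : Type} {a : α} {X : List α} (h : 2 ≤ X.count a) :
    ∃ Y Z₁ Z₂, X = Y ++ a :: (Z₁ ++ a :: Z₂) := by
  have h1 : a ∈ X := List.count_pos_iff.1 (by omega)
  obtain ⟨Y, Z, rfl, hY⟩ := List.append_of_mem h1 |>.elim fun Y hY => hY.elim fun Z hZ =>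
    (show ∃ Y Z, X = Y ++ a :: Z ∧ a ∉ Y from List.eq_append_cons_of_mem h1)
  have h2 : a ∈ Z := by
    apply List.count_pos_iff.1
    rw [List.count_append, List.count_eq_zero_of_not_mem hY] at h
    simp at h; exact List.count_pos_iff.2 h
  obtain ⟨Z₁, Z₂, rfl⟩ := List.append_of_mem h2
  exact ⟨Y, Z₁, Z₂, rfl⟩

/-- Extraction of a closed path as a contiguous subpath. -/
theorem aux_extract {c2 : Prop} (hc : c2) : ∀ (B A X : List Q.A) (v : Q.V),
    B.Nodup → Q.IsPathFrom v v (B ++ A) → Q.IsPathFrom v v (X ++ A) →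
    (∀ b ∈ B, 2 ≤ X.count b) →
    ∃ (R : List Q.A) (t : Q.V), Q.IsPathFrom t t (R ++ (A ++ B)) ∧ Q.IsPathFrom t t (A ++ B) ∧
      Q.PathEquiv c2 (X ++ A) (R ++ (A ++ B)) ∧ (X ++ A).Perm (R ++ (A ++ B)) := by
  intro B
  induction B with
  | nil =>
    intro A X v _ hp hX _
    exact ⟨X, v, by simpa using hX, by simpa using hp, by simpa [PathEquiv] using PEquiv.refl _, by simp⟩
  | cons a B ih =>
    intro A X v hnd hp hX hcount
    obtain ⟨Y, Z₁, Z₂, rfl⟩ := aux_split2 (hcount a (by simp))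
    rw [List.nodup_cons] at hnd
    have hva : Q.src a = v := hp.1
    subst hva
    simp only [aux_append, aux_cons, List.append_assoc, List.cons_append] at hX
    obtain ⟨_, hY, rfl, _, hZ1, rfl, s, hZ2, hA⟩ := hX
    simp only [aux_append, aux_cons, List.cons_append, true_and] at hp
    obtain ⟨s', hB, hA'⟩ := hp
    obtain ⟨R, t, h1, h2, h3, h4⟩ := ih (A ++ [a]) (Z₁ ++ Y ++ a :: Z₂) (Q.tgt a) hnd.2
      (aux_comp hB (aux_comp hA' (aux_single a)))
      (aux_comp (aux_comp (aux_comp hZ1 hY) (aux_cat a hZ2 rfl)) (aux_comp hA (aux_single a)))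
      (by
        intro b hb
        have hba : b ≠ a := by rintro rfl; exact hnd.1 hb
        have := hcount b (by simp [hb])
        simp [List.count_append, List.count_cons, Ne.symm hba] at this ⊢
        omega)
    refine ⟨R, t, by simpa using h1, by simpa using h2, ?_, ?_⟩
    · have e1 : Q.PathEquiv c2 ([] ++ Y ++ (a :: Z₁) ++ (a :: Z₂ ++ A))
          ([] ++ (a :: Z₁) ++ Y ++ (a :: Z₂ ++ A)) := by
        apply aux_swap hc (v := Q.src a)
        · rfl
        · exact hY
        · exact ⟨rfl, hZ1⟩
        · rw [aux_append]; exact ⟨s, ⟨rfl, hZ2⟩, hA⟩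
      have e2 : Q.PathEquiv c2 ([a] ++ (Z₁ ++ Y ++ (a :: Z₂ ++ A)))
          ((Z₁ ++ Y ++ (a :: Z₂ ++ A)) ++ [a]) := by
        apply aux_rot (u := Q.src a)
        exact aux_comp (aux_single a) (aux_comp (aux_comp hZ1 hY) (aux_comp (aux_cat a hZ2 rfl) hA))
      have e3 := PEquiv.trans e1 (by simpa [PathEquiv] using e2)
      have e4 := PEquiv.trans e3 (by simpa [PathEquiv] using h3)
      simpa [PathEquiv] using e4
    · refine List.Perm.trans ?_ (by simpa using h4)
      rw [List.perm_iff_count]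
      intro b
      simp only [List.count_append, List.count_cons, List.count_nil]
      omega

/-- Second extraction, carrying along the first copy. -/
theorem aux_train {c2 : Prop} (hc : c2) : ∀ (B A X : List Q.A) (v : Q.V),
    B.Nodup → Q.IsPathFrom v v (B ++ A) → Q.IsPathFrom v v (X ++ A) →
    (∀ b ∈ B, 2 ≤ X.count b) →
    ∃ (R : List Q.A) (t : Q.V), Q.IsPathFrom t t (R ++ (A ++ B)) ∧ Q.IsPathFrom t t (A ++ B) ∧
      Q.PathEquiv c2 (B ++ A ++ (X ++ A)) (A ++ B ++ (R ++ (A ++ B))) := by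
  intro B
  induction B with
  | nil =>
    intro A X v _ hp hX _
    exact ⟨X, v, by simpa using hX, by simpa using hp, by simpa [PathEquiv] using PEquiv.refl _⟩
  | cons a B ih =>
    intro A X v hnd hp hX hcount
    obtain ⟨Y, Z₁, Z₂, rfl⟩ := aux_split2 (hcount a (by simp))
    rw [List.nodup_cons] at hnd
    have hva : Q.src a = v := hp.1
    subst hva
    simp only [aux_append, aux_cons, List.append_assoc, List.cons_append] at hX
    obtain ⟨_, hY, rfl, _, hZ1, rfl, s, hZ2, hA⟩ := hX
    simp only [aux_append, aux_cons, List.cons_append, true_and] at hp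
    obtain ⟨s', hB, hA'⟩ := hp
    obtain ⟨R, t, h1, h2, h3⟩ := ih (A ++ [a]) (Z₁ ++ Y ++ a :: Z₂) (Q.tgt a) hnd.2
      (aux_comp hB (aux_comp hA' (aux_single a)))
      (aux_comp (aux_comp (aux_comp hZ1 hY) (aux_cat a hZ2 rfl)) (aux_comp hA (aux_single a)))
      (by
        intro b hb
        have hba : b ≠ a := by rintro rfl; exact hnd.1 hb
        have := hcount b (by simp [hb])
        simp [List.count_append, List.count_cons, Ne.symm hba] at this ⊢
        omega)
    refine ⟨R, t, by simpa using h1, by simpa using h2, ?_⟩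
    have e1 : Q.PathEquiv c2 ((a :: B ++ A) ++ Y ++ (a :: Z₁) ++ (a :: Z₂ ++ A))
        ((a :: B ++ A) ++ (a :: Z₁) ++ Y ++ (a :: Z₂ ++ A)) := by
      apply aux_swap hc (v := Q.src a)
      · rw [aux_append]; exact ⟨s', ⟨rfl, hB⟩, hA'⟩
      · exact hY
      · exact ⟨rfl, hZ1⟩
      · rw [aux_append]; exact ⟨s, ⟨rfl, hZ2⟩, hA⟩
    have e2 : Q.PathEquiv c2 ([a] ++ (B ++ A ++ ((a :: Z₁) ++ Y ++ (a :: Z₂ ++ A))))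
        ((B ++ A ++ ((a :: Z₁) ++ Y ++ (a :: Z₂ ++ A))) ++ [a]) := by
      apply aux_rot (u := Q.src a)
      exact aux_comp (aux_single a) (aux_comp (aux_comp hB hA')
        (aux_comp (aux_comp (aux_cat a hZ1 rfl) hY) (aux_comp (aux_cat a hZ2 rfl) hA)))
    have e3 := PEquiv.trans e1 (by simpa [PathEquiv] using e2)
    have e4 := PEquiv.trans e3 (by simpa [PathEquiv] using h3)
    simpa [PathEquiv] using e4

theorem aux_zero {c2 : Prop} (hc : c2) {a : Q.A} {B : List Q.A} {v w₀ : Q.V} {h : List Q.A}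
    (hnd : (a :: B).Nodup) (hp : Q.IsPathFrom v v (a :: B)) (hh : Q.IsPathFrom w₀ w₀ h)
    (ha : 2 ≤ h.count a) (hB : ∀ b ∈ B, 3 ≤ h.count b) : Q.EquivZero c2 h := by
  have hnd' := List.nodup_cons.1 hnd
  have hcB : ∀ b ∈ B, B.count b = 1 := fun b hb => List.count_eq_one_of_mem hnd'.2 hb
  have hca : B.count a = 0 := List.count_eq_zero_of_not_mem hnd'.1
  obtain ⟨Y, Z, rfl⟩ := List.append_of_mem (List.count_pos_iff.1 (by omega : 0 < h.count a))
  have hva : Q.src a = v := hp.1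
  subst hva
  have hpB : Q.IsPathFrom (Q.tgt a) (Q.src a) B := hp.2
  have e1 : Q.PathEquiv c2 ((Y ++ [a]) ++ Z) (Z ++ (Y ++ [a])) := by
    apply aux_rot (u := w₀); simpa using hh
  simp only [aux_append, aux_cons] at hh
  obtain ⟨_, hY, rfl, hZ⟩ := hh
  obtain ⟨R, t, h1, h2, h3, h4⟩ := aux_extract hc B [a] (Z ++ Y) (Q.tgt a) hnd'.2
    (by rw [aux_append]; exact ⟨_, hpB, rfl, rfl⟩)
    (by simp only [aux_append]; exact ⟨_, ⟨_, hZ, hY⟩, rfl, rfl⟩)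
    (by
      intro b hb
      have hba : b ≠ a := by rintro rfl; exact hnd'.1 hb
      have := hB b hb
      simp [List.count_append, List.count_cons, Ne.symm hba] at this ⊢
      omega)
  obtain rfl : Q.src a = t := h2.1
  have hR : Q.IsPathFrom (Q.src a) (Q.src a) R := by
    obtain ⟨w, hw, hw'⟩ := (aux_append _ _ _ _).1 h1
    obtain rfl : Q.src a = w := hw'.1
    exact hw
  have e2 : Q.PathEquiv c2 (R ++ ([a] ++ B)) (([a] ++ B) ++ R) := aux_rot h1
  have hcnt : ∀ b, (Y ++ a :: Z).count b = R.count b + (a :: B).count b := by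
    intro b
    have := h4.count_eq b
    simp only [List.count_append, List.count_cons, List.count_nil] at this ⊢
    omega
  have haR : a ∈ R := by
    apply List.count_pos_iff.1
    have := hcnt a
    rw [List.count_cons_self, hca] at this
    omega
  obtain ⟨Y', Z', rfl⟩ := List.append_of_mem haR
  simp only [aux_append, aux_cons] at hR
  obtain ⟨_, hY', rfl, hZ'⟩ := hR
  have e3 : Q.PathEquiv c2 ((a :: B) ++ Y' ++ (a :: Z') ++ []) ((a :: B) ++ (a :: Z') ++ Y' ++ []) :=
    aux_swap hc (v := Q.src a) hp hY' ⟨rfl, hZ'⟩ rfl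
  have e4 : Q.PathEquiv c2 ([a] ++ (B ++ ((a :: Z') ++ Y'))) ((B ++ ((a :: Z') ++ Y')) ++ [a]) := by
    apply aux_rot (u := Q.src a)
    exact aux_comp (aux_single a) (aux_comp hpB (aux_comp (aux_cat a hZ' rfl) hY'))
  obtain ⟨R, t, h1', h2', h3'⟩ := aux_train hc B [a] (Z' ++ Y') (Q.tgt a) hnd'.2
    (by rw [aux_append]; exact ⟨_, hpB, rfl, rfl⟩)
    (by simp only [aux_append]; exact ⟨_, ⟨_, hZ', hY'⟩, rfl, rfl⟩)
    (by
      intro b hb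
      have hba : b ≠ a := by rintro rfl; exact hnd'.1 hb
      have := hB b hb
      rw [hcnt b, List.count_cons_of_ne (Ne.symm hba), hcB b hb] at this
      simp [List.count_append, List.count_cons, Ne.symm hba] at this ⊢
      omega)
  obtain rfl : Q.src a = t := h2'.1
  have hR : Q.IsPathFrom (Q.src a) (Q.src a) R := by
    obtain ⟨w, hw, hw'⟩ := (aux_append _ _ _ _).1 h1'
    obtain rfl : Q.src a = w := hw'.1
    exact hw
  have e5 : Q.PathEquiv c2 (([a] ++ B ++ R) ++ ([a] ++ B)) (([a] ++ B) ++ ([a] ++ B ++ R)) := by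
    apply aux_rot (u := Q.src a)
    rw [aux_append, ]
    refine ⟨Q.src a, ?_, h2'⟩
    rw [aux_append]
    exact ⟨_, h2', hR⟩
  have hcl : Q.IsClosedAt (Q.src a) ([a] ++ B) := ⟨by simp, h2'⟩
  have e6 : Q.EquivZero c2 (([a] ++ B) ++ ([a] ++ B) ++ R) := by
    by_cases hRn : R = []
    · subst hRn
      have := PEquiv.sq (Q := Q) (c2 := c2) _ _ false hc hcl
      simpa [EquivZero] using this
    · exact PEquiv.sq_mul _ _ _ false hcl ⟨hRn, hR⟩
  unfold EquivZero PathEquiv at *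
  simp only [List.append_assoc, List.cons_append, List.nil_append, List.append_nil] at *
  exact e1.trans (h3.trans (e2.trans (e3.trans (e4.trans (h3'.trans (e5.trans e6))))))

theorem aux_prim_nodup {l : List Q.A} (hl : Q.IsPrimitive l) : l.Nodup := by
  obtain ⟨v, hv⟩ := hl
  exact ((aux_prim_iff v l).1 hv).2.of_map _

/-- The key claim. -/
theorem aux_key {c2 : Prop} (hc : c2) {w₀ : Q.V} {h p : List Q.A}
    (hh : Q.IsPathFrom w₀ w₀ h) (h0 : ¬ Q.EquivZero c2 h) (hp : Q.IsPrimitive p)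
    (h2 : ∀ a ∈ p, 2 ≤ h.count a) :
    ∃ y z, y ≠ z ∧ y ∈ p ∧ z ∈ p ∧ h.count y = 2 ∧ h.count z = 2 := by
  by_contra hcon
  push Not at hcon
  have hnd := aux_prim_nodup hp
  obtain ⟨v, ⟨hne, hpv⟩, -⟩ := hp
  have hsp : ∃ a ∈ p, ∀ b ∈ p, b ≠ a → 3 ≤ h.count b := by
    by_cases hex : ∃ a ∈ p, h.count a = 2
    · obtain ⟨a, ha, ha2⟩ := hex
      refine ⟨a, ha, fun b hb hba => ?_⟩
      have := h2 b hb
      have := hcon a b (Ne.symm hba) ha hb ha2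
      omega
    · push Not at hex
      obtain ⟨a, ha⟩ := List.exists_mem_of_ne_nil p hne
      refine ⟨a, ha, fun b hb hba => ?_⟩
      have := h2 b hb
      have := hex b hb
      omega
  obtain ⟨a, ha, hb⟩ := hsp
  have ha2 := h2 a ha
  obtain ⟨Y, Z, rfl⟩ := List.append_of_mem ha
  have hperm : (Y ++ a :: Z).Perm (a :: (Z ++ Y)) := by
    rw [List.perm_iff_count]; intro b
    simp only [List.count_append, List.count_cons]; omega
  have hnd2 := hperm.nodup_iff.1 hnd
  apply h0
  simp only [aux_append, aux_cons] at hpv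
  obtain ⟨_, hY, rfl, hZ⟩ := hpv
  refine aux_zero hc (v := Q.src a) hnd2 ⟨rfl, ?_⟩ hh ha2 ?_
  · rw [aux_append]; exact ⟨_, hZ, hY⟩
  · intro b hbm
    apply hb b (hperm.mem_iff.2 (List.mem_cons_of_mem _ hbm))
    rintro rfl
    exact (List.nodup_cons.1 hnd2).1 hbm

/-! Circulations -/

def auxBal (M : Multiset Q.A) : Prop := M.map Q.src = M.map Q.tgt

theorem aux_path_bal (l : List Q.A) (u v : Q.V) (h : Q.IsPathFrom u v l) :
    Multiset.map Q.src (l : Multiset Q.A) + {v} = {u} + Multiset.map Q.tgt (l : Multiset Q.A) := by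
  induction l generalizing u with
  | nil => obtain rfl : u = v := h; simp
  | cons a l ih =>
    obtain ⟨rfl, h2⟩ := h
    have := ih _ h2
    rw [← Multiset.cons_coe, Multiset.map_cons, Multiset.map_cons, Multiset.cons_add, this]
    simp [Multiset.singleton_add]

theorem aux_closed_bal {l : List Q.A} {v : Q.V} (h : Q.IsPathFrom v v l) :
    auxBal (l : Multiset Q.A) := by
  have := aux_path_bal l v v h
  rw [add_comm] at this
  exact add_left_cancel this

theorem aux_prim_bal {l : List Q.A} (h : Q.IsPrimitive l) : auxBal (l : Multiset Q.A) := by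
  obtain ⟨v, ⟨-, hv⟩, -⟩ := h
  exact aux_closed_bal hv

theorem aux_bal_sub {M N : Multiset Q.A} (h : auxBal (M + N)) (hN : auxBal N) : auxBal M := by
  unfold auxBal at *
  rw [Multiset.map_add, Multiset.map_add, hN] at h
  exact add_right_cancel h

def auxWalk (g : Q.V → Q.A) : Q.V → ℕ → List Q.A
  | _, 0 => []
  | v, n + 1 => g v :: auxWalk g (Q.tgt (g v)) n

theorem aux_walk_path (g : Q.V → Q.A) (S : Set Q.V)
    (hg : ∀ v ∈ S, Q.src (g v) = v ∧ Q.tgt (g v) ∈ S) (n : ℕ) :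
    ∀ v ∈ S, Q.IsPathFrom v ((fun v => Q.tgt (g v))^[n] v) (auxWalk g v n) := by
  induction n with
  | zero => intro v _; rfl
  | succ n ih => intro v hv; exact ⟨(hg v hv).1, ih _ (hg v hv).2⟩

theorem aux_walk_mem (g : Q.V → Q.A) (S : Set Q.V) (P : Q.A → Prop)
    (hg : ∀ v ∈ S, P (g v) ∧ Q.tgt (g v) ∈ S) (n : ℕ) :
    ∀ v ∈ S, ∀ a ∈ auxWalk g v n, P a := by
  induction n with
  | zero => intro v _ a ha; simp [auxWalk] at ha
  | succ n ih =>
    intro v hv a ha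
    rcases List.mem_cons.1 ha with rfl | ha
    · exact (hg v hv).1
    · exact ih _ (hg v hv).2 a ha

theorem aux_walk_tgt (g : Q.V → Q.A) (n : ℕ) : ∀ v,
    (auxWalk g v n).map Q.tgt =
      (List.range n).map (fun i => (fun v => Q.tgt (g v))^[i] (Q.tgt (g v))) := by
  induction n with
  | zero => intro v; rfl
  | succ n ih =>
    intro v
    rw [List.range_succ_eq_map]
    simp [auxWalk, ih, Function.comp_def]

theorem aux_exists_prim {M : Multiset Q.A} (hM : auxBal M) (hne : M ≠ 0) :
    ∃ l, Q.IsPrimitive l ∧ (l : Multiset Q.A) ≤ M := by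
  obtain ⟨a₀, ha₀⟩ := Multiset.exists_mem_of_ne_zero hne
  have hnext : ∀ v, ∃ b, v ∈ M.map Q.tgt → b ∈ M ∧ Q.src b = v := by
    intro v
    by_cases hv : v ∈ M.map Q.tgt
    · have hv' := hv
      rw [← (hM : M.map Q.src = M.map Q.tgt)] at hv'
      obtain ⟨b, hb⟩ := Multiset.mem_map.1 hv'
      exact ⟨b, fun _ => hb⟩
    · exact ⟨a₀, fun h => absurd h hv⟩
  choose g hg using hnext
  set φ : Q.V → Q.V := fun v => Q.tgt (g v) with hφ
  have hS : ∀ v ∈ {v | v ∈ M.map Q.tgt}, φ v ∈ {v | v ∈ M.map Q.tgt} := fun v hv =>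
    Multiset.mem_map_of_mem _ (hg v hv).1
  have hfin : Set.Finite {v | v ∈ M.map Q.tgt} := by
    refine ((M.map Q.tgt).toFinset.finite_toSet).subset ?_
    intro v hv; simpa using hv
  have hit : ∀ n, φ^[n] (Q.tgt a₀) ∈ {v | v ∈ M.map Q.tgt} := by
    intro n
    induction n with
    | zero => exact Multiset.mem_map_of_mem _ ha₀
    | succ n ih => rw [Function.iterate_succ_apply']; exact hS _ ih
  obtain ⟨i, j, hij, heq⟩ := hfin.exists_lt_map_eq_of_forall_mem hit
  set v := φ^[i] (Q.tgt a₀) with hv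
  have hper : Function.IsPeriodicPt φ (j - i) v := by
    unfold Function.IsPeriodicPt Function.IsFixedPt
    rw [hv, ← Function.iterate_add_apply, Nat.sub_add_cancel hij.le, ← heq]
  have hpp : v ∈ Function.periodicPts φ := ⟨j - i, by omega, hper⟩
  have hpos := Function.minimalPeriod_pos_of_mem_periodicPts hpp
  have hvS := hit i
  have hclosed := aux_walk_path g {v | v ∈ M.map Q.tgt}
    (fun v hv => ⟨(hg v hv).2, hS v hv⟩) (Function.minimalPeriod φ v) v hvS
  have hmp : φ^[Function.minimalPeriod φ v] v = v := Function.isPeriodicPt_minimalPeriod φ v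
  rw [← hφ, hmp] at hclosed
  have hnd : ((auxWalk g v (Function.minimalPeriod φ v)).map Q.tgt).Nodup := by
    rw [aux_walk_tgt]
    have := Function.nodup_periodicOrbit (f := φ) (x := φ v)
    rw [Function.periodicOrbit, Cycle.nodup_coe_iff, Function.minimalPeriod_apply hpp] at this
    exact this
  refine ⟨auxWalk g v (Function.minimalPeriod φ v), ⟨v, ?_⟩, ?_⟩
  · rw [aux_prim_iff]
    refine ⟨⟨?_, hclosed⟩, hnd⟩
    obtain ⟨n, hn⟩ := Nat.exists_eq_succ_of_ne_zero hpos.ne'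
    rw [hn]; simp [auxWalk]
  · rw [Multiset.le_iff_subset (by exact hnd.of_map _)]
    intro a ha
    exact aux_walk_mem g {v | v ∈ M.map Q.tgt} (fun a => a ∈ M)
      (fun v hv => ⟨(hg v hv).1, hS v hv⟩) _ v hvS a ha

theorem aux_prim_card {l : List Q.A} (h : Q.IsPrimitive l) : 0 < (l : Multiset Q.A).card := by
  obtain ⟨v, ⟨hne, -⟩, -⟩ := h
  simpa using List.length_pos_iff.2 hne

theorem aux_decomp (n : ℕ) : ∀ M : Multiset Q.A, M.card = n → auxBal M →
    ∃ bs : List (List Q.A), (∀ l ∈ bs, Q.IsPrimitive l) ∧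
      ∀ e, M.count e = (bs.map (fun l => l.count e)).sum := by
  induction n using Nat.strong_induction_on with
  | _ n ih =>
    intro M hn hM
    by_cases h0 : M = 0
    · exact ⟨[], by simp, by simp [h0]⟩
    obtain ⟨l, hl, hle⟩ := aux_exists_prim hM h0
    obtain ⟨N, rfl⟩ := Multiset.le_iff_exists_add.1 hle
    have hc := aux_prim_card hl
    rw [Multiset.card_add] at hn
    obtain ⟨bs, h1, h2⟩ := ih N.card (by omega) N rfl
      (aux_bal_sub (by rwa [add_comm] at hM) (aux_prim_bal hl))
    refine ⟨l :: bs, ?_, ?_⟩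
    · intro l' hl'
      rcases List.mem_cons.1 hl' with rfl | hl'
      · exact hl
      · exact h1 _ hl'
    · intro e; rw [Multiset.count_add, h2]; simp

theorem aux_max (n : ℕ) : ∀ M : Multiset Q.A, M.card = n → auxBal M →
    ∃ (cs : List (List Q.A)) (N : Multiset Q.A), (∀ l ∈ cs, Q.IsPrimitive l) ∧ auxBal N ∧
      (∀ e, M.count e = N.count e + 2 * (cs.map (fun l => l.count e)).sum) ∧
      ∀ p, Q.IsPrimitive p → ¬ ((p : Multiset Q.A) + p ≤ N) := by
  induction n using Nat.strong_induction_on with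
  | _ n ih =>
    intro M hn hM
    by_cases h0 : ∃ p, Q.IsPrimitive p ∧ ((p : Multiset Q.A) + p ≤ M)
    · obtain ⟨l, hl, hle⟩ := h0
      obtain ⟨N, rfl⟩ := Multiset.le_iff_exists_add.1 hle
      have hc := aux_prim_card hl
      simp only [Multiset.card_add] at hn
      have hb := aux_prim_bal hl
      obtain ⟨cs, N', h1, h2, h3, h4⟩ := ih N.card (by omega) N rfl
        (aux_bal_sub (aux_bal_sub (by rw [add_assoc, add_comm]; exact hM) hb) hb)
      refine ⟨l :: cs, N', ?_, h2, ?_, h4⟩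
      · intro l' hl'
        rcases List.mem_cons.1 hl' with rfl | hl'
        · exact hl
        · exact h1 _ hl'
      · intro e
        rw [Multiset.count_add, Multiset.count_add, h3]; simp; ring
    · push Not at h0
      exact ⟨[], M, by simp, hM, by simp, h0⟩

theorem aux_sum_get (cs : List (List Q.A)) (e : Q.A) :
    (cs.map (fun l => l.count e)).sum = ∑ i, (cs.get i).count e := by
  rw [← List.sum_ofFn]
  congr 1
  apply List.ext_getElem <;> simp

theorem aux_two_le {n : ℕ} (f : Fin n → List Q.A) {i j : Fin n} (hij : i ≠ j) {e : Q.A}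
    (hi : e ∈ f i) (hj : e ∈ f j) : 2 ≤ ∑ k, (f k).count e := by
  have h1 := List.count_pos_iff.2 hi
  have h2 := List.count_pos_iff.2 hj
  have := Finset.sum_le_sum_of_subset (f := fun k => (f k).count e) (Finset.subset_univ {i, j})
  rw [Finset.sum_pair hij] at this
  omega

theorem aux_one_le {n : ℕ} (f : Fin n → List Q.A) {i : Fin n} {e : Q.A}
    (hi : e ∈ f i) : 1 ≤ ∑ k, (f k).count e := by
  have h1 := List.count_pos_iff.2 hi
  have := Finset.single_le_sum (f := fun k => (f k).count e) (fun _ _ => Nat.zero_le _)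
    (Finset.mem_univ i)
  omega

end QuiverData

/-- **Lemma (multidegree decomposition).** Let `char K = 2` and let `h` be a closed
path in a quiver `Q` with `h ≢ 0`.  Then there exist pairwise different primitive
closed paths `b₁, …, b_r`, `c₁, …, c_t` in `Q` (`r, t ≥ 0`) such that
`mdeg h = Σᵢ mdeg bᵢ + 2 Σ_k mdeg c_k`, and pairwise different arrows
`x₁, …, x_r`, `y₁, …, y_t`, `z₁, …, z_t` such that `y_j, z_j ∈ Arr(c_j)` with
`deg_{y_j}(h) = deg_{z_j}(h) = 2`, and `x_i ∈ Arr(b_i)` with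
`deg_{x_i}(h) − 2 Σ_k deg_{x_i}(c_k) = 1`. -/
theorem multidegree_decomposition
    (K : Type) [Field K] [Infinite K] (hchar : ringChar K = 2)
    (Q : QuiverData) (w₀ : Q.V) (h : List Q.A) (hcl : Q.IsClosedAt w₀ h)
    (h0 : ¬ Q.EquivZero (ringChar K = 2) h) :
    ∃ (r t : ℕ) (b : Fin r → List Q.A) (c : Fin t → List Q.A),
      (∀ i, Q.IsPrimitive (b i)) ∧ (∀ k, Q.IsPrimitive (c k)) ∧
      (∀ i j, b i = b j → i = j) ∧ (∀ i j, c i = c j → i = j) ∧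
      (∀ i j, b i ≠ c j) ∧
      (∀ e : Q.A, Q.adeg h e = (∑ i, Q.adeg (b i) e) + 2 * ∑ k, Q.adeg (c k) e) ∧
      ∃ (x : Fin r → Q.A) (y z : Fin t → Q.A),
        Function.Injective x ∧ Function.Injective y ∧ Function.Injective z ∧
        (∀ i j, x i ≠ y j) ∧ (∀ i j, x i ≠ z j) ∧ (∀ i j, y i ≠ z j) ∧
        (∀ j, y j ∈ c j ∧ z j ∈ c j ∧ Q.adeg h (y j) = 2 ∧ Q.adeg h (z j) = 2) ∧
        (∀ i, x i ∈ b i ∧ Q.adeg h (x i) = 2 * (∑ k, Q.adeg (c k) (x i)) + 1) := by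
  obtain ⟨hne, hh⟩ := hcl
  obtain ⟨cs, N, hcs, hN, hcount, hmax⟩ :=
    QuiverData.aux_max _ (h : Multiset Q.A) rfl (QuiverData.aux_closed_bal hh)
  obtain ⟨bs, hbs, hbcount⟩ := QuiverData.aux_decomp _ N rfl hN
  replace hcount : ∀ e, h.count e = N.count e + 2 * ∑ i, (cs.get i).count e := by
    intro e
    rw [← QuiverData.aux_sum_get, ← hcount e, Multiset.coe_count]
  replace hbcount : ∀ e, N.count e = ∑ i, (bs.get i).count e := by
    intro e
    rw [← QuiverData.aux_sum_get, ← hbcount e]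
  have hb : ∀ i, Q.IsPrimitive (bs.get i) := fun i => hbs _ (List.get_mem _ _)
  have hc : ∀ i, Q.IsPrimitive (cs.get i) := fun i => hcs _ (List.get_mem _ _)
  have hyz : ∀ k, ∃ y z, y ≠ z ∧ y ∈ cs.get k ∧ z ∈ cs.get k ∧ h.count y = 2 ∧ h.count z = 2 := by
    intro k
    apply QuiverData.aux_key hchar hh h0 (hc k)
    intro a ha
    have := hcount a
    have := QuiverData.aux_one_le cs.get ha
    omega
  choose y z hyz hy hz hy2 hz2 using hyz
  have hx : ∀ i, ∃ x ∈ bs.get i, N.count x = 1 := by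
    intro i
    by_contra hcon
    push Not at hcon
    apply hmax _ (hb i)
    rw [Multiset.le_iff_count]
    intro e
    rw [Multiset.count_add, Multiset.coe_count]
    by_cases he : e ∈ bs.get i
    · have h1 := List.count_eq_one_of_mem (QuiverData.aux_prim_nodup (hb i)) he
      have := hcon e he
      have := hbcount e
      have := QuiverData.aux_one_le bs.get he
      omega
    · rw [List.count_eq_zero_of_not_mem he]; omega
  choose x hx hx1 using hx
  -- an arrow of `c j` of degree two in `h` lies in nothing else
  have priv : ∀ e j, e ∈ cs.get j → h.count e = 2 → N.count e = 0 ∧ ∀ j', e ∈ cs.get j' → j' = j := by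
    intro e j he h2
    have h3 := hcount e
    have h4 := QuiverData.aux_one_le cs.get he
    refine ⟨by omega, fun j' hj' => ?_⟩
    by_contra hne
    have := QuiverData.aux_two_le cs.get hne hj' he
    omega
  have privx : ∀ i i', x i ∈ bs.get i' → i' = i := by
    intro i i' hi'
    by_contra hne
    have h1 := QuiverData.aux_two_le bs.get hne hi' (hx i)
    have h2 := hbcount (x i)
    have h3 := hx1 i
    omega
  refine ⟨bs.length, cs.length, bs.get, cs.get, hb, hc, ?_, ?_, ?_, ?_, x, y, z,
    ?_, ?_, ?_, ?_, ?_, ?_, ?_, ?_⟩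
  · intro i j hij
    exact privx j i (hij ▸ hx j)
  · intro i j hij
    exact (priv _ j (hy j) (hy2 j)).2 i (hij ▸ hy j)
  · intro i j hij
    have h1 := (priv _ j (hy j) (hy2 j)).1
    have h2 : y j ∈ bs.get i := by rw [hij]; exact hy j
    have h3 := QuiverData.aux_one_le bs.get h2
    have h4 := hbcount (y j)
    omega
  · intro e
    simp only [QuiverData.aux_adeg]
    rw [hcount e, hbcount e]
  · intro i j hij
    exact privx j i (hij ▸ hx i)
  · intro i j hij
    exact (priv _ j (hy j) (hy2 j)).2 i (hij ▸ hy i)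
  · intro i j hij
    exact (priv _ j (hz j) (hz2 j)).2 i (hij ▸ hz i)
  · intro i j hij
    have h1 := (priv _ j (hy j) (hy2 j)).1
    rw [← hij, hx1] at h1
    omega
  · intro i j hij
    have h1 := (priv _ j (hz j) (hz2 j)).1
    rw [← hij, hx1] at h1
    omega
  · intro i j hij
    have h1 := (priv _ j (hz j) (hz2 j)).2 i (hij ▸ hy i)
    subst h1
    exact hyz i hij
  · intro j
    simp only [QuiverData.aux_adeg]
    exact ⟨hy j, hz j, hy2 j, hz2 j⟩
  · intro i
    simp only [QuiverData.aux_adeg]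
    refine ⟨hx i, ?_⟩
    rw [hcount (x i), hx1]
    omega
end

section
/- Let K be an infinite field with char(K) = 2 and let Q be a quiver with d arrows such that the maximal degree of primitive closed paths in Q is m. If h is a closed path in Q with h ≢ 0, then deg(h) ≤ m·d. -/
open Classical BigOperators

namespace QuiverData

variable {Q : QuiverData}

theorem path_append {u w : Q.V} {a b : List Q.A} :
    Q.IsPathFrom u w (a ++ b) ↔ ∃ v, Q.IsPathFrom u v a ∧ Q.IsPathFrom v w b := by
  induction a generalizing u with
  | nil => simp [IsPathFrom]
  | cons c l ih => simp [IsPathFrom, ih, and_assoc]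

theorem path_trans {u v w : Q.V} {a b : List Q.A} (ha : Q.IsPathFrom u v a)
    (hb : Q.IsPathFrom v w b) : Q.IsPathFrom u w (a ++ b) :=
  path_append.2 ⟨v, ha, hb⟩

/-- Swapping of (possibly empty) closed factors when the characteristic is two. -/
theorem swap2 {c2 : Prop} (hc : c2) {v : Q.V} {p c d q : List Q.A}
    (hp : Q.IsPathFrom v v p) (hc' : Q.IsPathFrom v v c) (hd : Q.IsPathFrom v v d)
    (hq : Q.IsPathFrom v v q) :
    Q.PEquiv c2 (some (false, p ++ c ++ d ++ q)) (some (false, p ++ d ++ c ++ q)) := by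
  by_cases h1 : c = []
  · subst h1; simp; exact PEquiv.refl _
  by_cases h2 : d = []
  · subst h2; simp; exact PEquiv.refl _
  have := PEquiv.swap (c2 := c2) v p c d q false hp ⟨h1, hc'⟩ ⟨h2, hd⟩ hq
  simpa [hc] using this

theorem split_two {α : Type} {c : α} {x : List α} (h : 2 ≤ x.count c) :
    ∃ x1 x2 x3, x = x1 ++ c :: (x2 ++ c :: x3) := by
  have hm : c ∈ x := List.count_pos_iff.1 (by omega)
  obtain ⟨x1, t, rfl, hn⟩ := List.eq_append_cons_of_mem hm
  have h0 : x1.count c = 0 := List.count_eq_zero.2 hn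
  have hm2 : c ∈ t := by
    apply List.count_pos_iff.1
    rw [List.count_append, h0, List.count_cons_self] at h
    omega
  obtain ⟨x2, x3, rfl⟩ := List.append_of_mem hm2
  exact ⟨x1, x2, x3, rfl⟩

theorem rearrange {c2 : Prop} (hc : c2) {u v : Q.V} {e x1 x2 x3 y : List Q.A} {c : Q.A}
    (hs : Q.src c = v) (he : Q.IsPathFrom u v e)
    (hx : Q.IsPathFrom v u (x1 ++ c :: (x2 ++ c :: x3))) (hy : Q.IsPathFrom v u y) :
    Q.IsPathFrom (Q.tgt c) u x3 ∧ Q.IsPathFrom (Q.tgt c) u (x2 ++ x1 ++ y) ∧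
    Q.PEquiv c2 (some (false, e ++ (x1 ++ c :: (x2 ++ c :: x3)) ++ e ++ y))
      (some (false, (e ++ [c]) ++ x3 ++ (e ++ [c]) ++ (x2 ++ x1 ++ y))) := by
  have hx' := hx
  obtain ⟨t, h1, h2⟩ := path_append.1 hx
  obtain ⟨h3, h4⟩ := h2
  obtain ⟨t2, h5, h6⟩ := path_append.1 h4
  obtain ⟨h7, h8⟩ := h6
  have et : t = v := by rw [← h3, hs]
  have et2 : t2 = v := by rw [← h7, hs]
  subst et2
  subst et
  refine ⟨h8, path_trans (path_trans h5 h1) hy, ?_⟩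
  have hB : Q.IsPathFrom t t (c :: x2) := ⟨hs, h5⟩
  have hD : Q.IsPathFrom t t (c :: x3 ++ e) := path_trans (v := u) (a := c :: x3) ⟨hs, h8⟩ he
  have hE : Q.IsPathFrom t t (y ++ e) := path_trans hy he
  have hnil : Q.IsPathFrom t t [] := rfl
  have r1 := PEquiv.cyc (c2 := c2) u t e ((x1 ++ c :: (x2 ++ c :: x3)) ++ e ++ y) false he
    (path_trans (path_trans hx' he) hy) (by simp)
  have r2 := swap2 hc h1 hB hD hE
  have r3 := swap2 hc hnil h1 (path_trans hD hB) hE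
  have r4 := PEquiv.cyc (c2 := c2) t u ((c :: x3 ++ e) ++ (c :: x2) ++ x1 ++ y) e false
    (path_trans (path_trans (path_trans hD hB) h1) hy) he (by simp)
  simp only [List.append_assoc, List.cons_append, List.nil_append] at r1 r2 r3 r4 ⊢
  exact ((r1.trans r2).trans r3).trans r4

theorem zero_aux {c2 : Prop} (hc : c2) (h : List Q.A) (u : Q.V) (rest : List Q.A) :
    ∀ (v : Q.V) (e x y : List Q.A), e ≠ [] → Q.IsPathFrom u v e → Q.IsPathFrom v u rest →
      (e ++ rest).Nodup → (∀ c ∈ rest, 3 ≤ h.count c) →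
      Q.IsPathFrom v u x → Q.IsPathFrom v u y → h.Perm (e ++ x ++ e ++ y) →
      Q.PEquiv c2 (some (false, h)) (some (false, e ++ x ++ e ++ y)) →
      Q.EquivZero c2 h := by
  induction rest with
  | nil =>
    intro v e x y hne he hr _ _ hx hy _ heq
    have hvu : v = u := hr
    subst hvu
    have s1 := swap2 hc he hx he hy
    refine (heq.trans s1).trans ?_
    by_cases hxy : x ++ y = []
    · have := PEquiv.sq (c2 := c2) v e false hc ⟨hne, he⟩
      simp at hxy
      simpa [hxy.1, hxy.2] using this
    · have := PEquiv.sq_mul (c2 := c2) v e (x ++ y) false ⟨hne, he⟩ ⟨hxy, path_trans hx hy⟩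
      simpa using this
  | cons c rest ih =>
    intro v e x y hne he hr hnd hcnt hx hy hperm heq
    obtain ⟨hs, hr'⟩ := hr
    have hce : e.count c = 0 := by
      apply List.count_eq_zero.2
      intro hmem
      exact (List.nodup_append.1 hnd).2.2 c hmem c (by simp) rfl
    have h3 := hcnt c (by simp)
    rw [hperm.count_eq] at h3
    simp only [List.count_append, hce] at h3
    have he' : Q.IsPathFrom u (Q.tgt c) (e ++ [c]) := path_trans he ⟨hs, rfl⟩
    have hcnt' : ∀ c ∈ rest, 3 ≤ h.count c := fun b hb => hcnt b (by simp [hb])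
    have main : ∀ x y : List Q.A, Q.IsPathFrom v u x → Q.IsPathFrom v u y →
        h.Perm (e ++ x ++ e ++ y) →
        Q.PEquiv c2 (some (false, h)) (some (false, e ++ x ++ e ++ y)) →
        2 ≤ x.count c → Q.EquivZero c2 h := by
      intro x y hx hy hperm heq h2
      obtain ⟨x1, x2, x3, rfl⟩ := split_two h2
      obtain ⟨g1, g2, g3⟩ := rearrange hc hs he hx hy
      refine ih (Q.tgt c) (e ++ [c]) x3 (x2 ++ x1 ++ y) (by simp) he' hr' (by simpa using hnd)
        hcnt' g1 g2 (hperm.trans ?_) (heq.trans g3)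
      rw [List.perm_iff_count]
      intro a
      simp [List.count_append, List.count_cons]
      omega
    by_cases h2 : 2 ≤ x.count c
    · exact main x y hx hy hperm heq h2
    · refine main y x hy hx (hperm.trans ?_) (heq.trans ?_) (by omega)
      · rw [List.perm_iff_count]
        intro a
        simp [List.count_append]
        omega
      · have := PEquiv.cyc (c2 := c2) u u (e ++ x) (e ++ y) false (path_trans he hx)
          (path_trans he hy) (by simp [hne])
        simpa using this

/-- A closed path with a doubled arrow and otherwise tripled arrows forces `h ≡ 0`. -/
theorem zero_of_cycle {c2 : Prop} (hc : c2) {w u : Q.V} {h : List Q.A} (hh : Q.IsPathFrom w w h)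
    {a : Q.A} {rest : List Q.A} (hC : Q.IsPathFrom u u (a :: rest)) (hnd : (a :: rest).Nodup)
    (ha : 2 ≤ h.count a) (hr : ∀ c ∈ rest, 3 ≤ h.count c) : Q.EquivZero c2 h := by
  obtain ⟨p, q, r, rfl⟩ := split_two ha
  obtain ⟨hs, hrest⟩ := hC
  obtain ⟨t, h1, h2⟩ := path_append.1 hh
  have h2' := h2
  obtain ⟨h3, h4⟩ := h2
  obtain ⟨t2, h5, h6⟩ := path_append.1 h4
  obtain ⟨h7, h8⟩ := h6
  have et : t = u := by rw [← h3, hs]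
  have et2 : t2 = u := by rw [← h7, hs]
  subst et2
  subst et
  refine zero_aux hc _ t rest (Q.tgt a) [a] q (r ++ p) (by simp) ⟨hs, rfl⟩ hrest hnd hr h5
    (path_trans h8 h1) ?_ ?_
  · rw [List.perm_iff_count]
    intro b
    simp [List.count_append, List.count_cons]
    omega
  · have := PEquiv.cyc (c2 := c2) w t p (a :: (q ++ a :: r)) false h1 h2' (by simp)
    simpa using this

theorem two_small {c2 : Prop} (hc : c2) {w u : Q.V} {h : List Q.A} (hh : Q.IsPathFrom w w h)
    (h0 : ¬ Q.EquivZero c2 h) {C : List Q.A} (hne : C ≠ []) (hC : Q.IsPathFrom u u C)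
    (hnd : C.Nodup) (h2 : ∀ c ∈ C, 2 ≤ h.count c) :
    ∃ b ∈ C, ∃ c ∈ C, b ≠ c ∧ h.count b ≤ 2 ∧ h.count c ≤ 2 := by
  by_contra hcon
  push Not at hcon
  apply h0
  have : ∃ b ∈ C, ∀ c ∈ C, c ≠ b → 3 ≤ h.count c := by
    by_cases hb : ∃ b ∈ C, h.count b ≤ 2
    · obtain ⟨b, hb, hb2⟩ := hb
      exact ⟨b, hb, fun c hc' hn => hcon b hb c hc' hn.symm hb2⟩
    · push Not at hb
      obtain ⟨b, hb'⟩ := List.exists_mem_of_ne_nil C hne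
      exact ⟨b, hb', fun c hc' _ => hb c hc'⟩
  obtain ⟨b, hbC, hb⟩ := this
  obtain ⟨p, q, rfl⟩ := List.append_of_mem hbC
  obtain ⟨t, h1, h3⟩ := path_append.1 hC
  have hnd' : (b :: (q ++ p)).Nodup := by
    refine (List.Perm.nodup_iff ?_).1 hnd
    exact List.perm_append_comm (l₁ := p) (l₂ := b :: q)
  refine zero_of_cycle hc hh (a := b) (rest := q ++ p) (path_trans (a := b :: q) h3 h1) hnd'
    (h2 b hbC) ?_
  intro c hc'
  refine hb c ?_ ?_
  · simp at hc' ⊢; tauto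
  · rintro rfl
    exact (List.nodup_cons.1 hnd').1 hc'

/-- Balanced multisets of arrows. -/
def Bal (s : Multiset Q.A) : Prop := s.map Q.tgt = s.map Q.src

theorem path_bal {u v : Q.V} {l : List Q.A} (hl : Q.IsPathFrom u v l) :
    u ::ₘ (l : Multiset Q.A).map Q.tgt = v ::ₘ (l : Multiset Q.A).map Q.src := by
  induction l generalizing u with
  | nil => have : u = v := hl; simp [this]
  | cons a l ih =>
    obtain ⟨h1, h2⟩ := hl
    have := ih h2
    rw [← Multiset.cons_coe, Multiset.map_cons, Multiset.map_cons, this, h1,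
      Multiset.cons_swap]

theorem closed_bal {u : Q.V} {l : List Q.A} (hl : Q.IsPathFrom u u l) :
    Bal (l : Multiset Q.A) :=
  (Multiset.cons_inj_right u).1 (path_bal hl)

theorem exists_cycle_aux [Fintype Q.A] {s : Multiset Q.A} (hs : Bal s) :
    ∀ (k : ℕ) (l : List Q.A) (u v : Q.V), Fintype.card Q.A - l.length = k → l ≠ [] →
      Q.IsPathFrom u v l → (l.map Q.tgt).Nodup → (∀ a ∈ l, a ∈ s) →
      (∃ C w, C ≠ [] ∧ Q.IsPathFrom w w C ∧ (C.map Q.tgt).Nodup ∧ ∀ a ∈ C, a ∈ s) := by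
  intro k
  induction k using Nat.strong_induction_on with
  | _ k ih =>
  intro l u v hk hne hp hnd hmem
  have hv : ∃ a ∈ l, Q.tgt a = v := by
    refine ⟨l.getLast hne, List.getLast_mem hne, ?_⟩
    rw [← List.dropLast_append_getLast hne] at hp
    obtain ⟨t, _, h2⟩ := path_append.1 hp
    exact h2.2
  obtain ⟨a, hal, hav⟩ := hv
  have hvs : v ∈ s.map Q.src := by
    rw [← hs, ← hav]
    exact Multiset.mem_map_of_mem _ (hmem a hal)
  obtain ⟨b, hbs, hbv⟩ := Multiset.mem_map.1 hvs
  by_cases hb : Q.tgt b ∈ l.map Q.tgt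
  · obtain ⟨c, hcl, hcb⟩ := List.mem_map.1 hb
    obtain ⟨p, q, rfl⟩ := List.append_of_mem hcl
    obtain ⟨t, _, h2⟩ := path_append.1 hp
    refine ⟨q ++ [b], Q.tgt b, by simp, ?_, ?_, ?_⟩
    · refine path_trans (v := v) ?_ ⟨hbv, rfl⟩
      rw [← hcb]
      exact h2.2
    · rw [List.map_append, List.map_cons, List.nodup_append] at hnd
      have h3 := List.nodup_cons.1 hnd.2.1
      have : ((b :: q).map Q.tgt).Nodup := by
        rw [List.map_cons, ← hcb]
        exact hnd.2.1
      refine (List.Perm.nodup_iff ?_).1 this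
      exact (List.perm_append_comm (l₁ := [b]) (l₂ := q)).map _
    · intro d hd
      rw [List.mem_append] at hd
      rcases hd with hd | hd
      · exact hmem d (by simp [hd])
      · simp at hd; rw [hd]; exact hbs
  · have hnd2 : ((l ++ [b]).map Q.tgt).Nodup := by
      have : ((b :: l).map Q.tgt).Nodup := by
        rw [List.map_cons]; exact List.nodup_cons.2 ⟨hb, hnd⟩
      refine (List.Perm.nodup_iff ?_).1 this
      exact (List.perm_append_comm (l₁ := [b]) (l₂ := l)).map _
    have hlen := (List.Nodup.of_map _ hnd2).length_le_card
    simp at hlen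
    refine ih (Fintype.card Q.A - (l ++ [b]).length) (by simp; omega) (l ++ [b]) u (Q.tgt b)
      rfl (by simp) (path_trans hp ⟨hbv, rfl⟩) hnd2 ?_
    intro d hd
    rw [List.mem_append] at hd
    rcases hd with hd | hd
    · exact hmem d hd
    · simp at hd; rw [hd]; exact hbs

theorem exists_cycle [Fintype Q.A] {s : Multiset Q.A} (hs : Bal s) (h0 : s ≠ 0) :
    ∃ C w, C ≠ [] ∧ Q.IsPathFrom w w C ∧ (C.map Q.tgt).Nodup ∧ ∀ a ∈ C, a ∈ s := by
  obtain ⟨a, ha⟩ := Multiset.exists_mem_of_ne_zero h0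
  exact exists_cycle_aux hs _ [a] (Q.src a) (Q.tgt a) rfl (by simp) ⟨rfl, rfl⟩ (by simp)
    (by simpa using ha)

theorem prim_of_nodup {w : Q.V} {C : List Q.A} (hne : C ≠ []) (hC : Q.IsPathFrom w w C)
    (hnd : (C.map Q.tgt).Nodup) : Q.IsPrimitive C := by
  refine ⟨w, ⟨hne, hC⟩, ?_⟩
  intro a ha
  obtain ⟨i, hi⟩ := List.mem_iff_get.1 ha
  unfold vdeg
  rw [Nat.card_eq_one_iff_exists]
  refine ⟨⟨i, by rw [hi]⟩, ?_⟩
  rintro ⟨j, hj⟩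
  apply Subtype.ext
  apply Fin.ext
  have := (List.Nodup.getElem_inj_iff hnd (i := j.1) (hi := by simp) (j := i.1)
    (hj := by simp)).1
  apply this
  simp only [List.getElem_map]
  simp only [List.get_eq_getElem] at hj hi
  rw [hj, hi]

theorem card_bound [Fintype Q.A] {m : ℕ} (hm : Q.MaxPrimDeg m) {g : Multiset Q.A}
    (hg : ∀ (u : Q.V) (C : List Q.A), C ≠ [] → Q.IsPathFrom u u C → C.Nodup →
      (∀ c ∈ C, 2 ≤ g.count c) →
      ∃ b ∈ C, ∃ c ∈ C, b ≠ c ∧ g.count b ≤ 2 ∧ g.count c ≤ 2) :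
    ∀ (k : ℕ) (s : Multiset Q.A), s.card = k → s ≤ g → Bal s →
      s.card ≤ m * s.toFinset.card := by
  intro k
  induction k using Nat.strong_induction_on with
  | _ k ih =>
  intro s hk hsg hs
  by_cases h0 : s = 0
  · simp [h0]
  obtain ⟨C, w, hne, hC, hndt, hmem⟩ := exists_cycle hs h0
  have hnd : C.Nodup := List.Nodup.of_map _ hndt
  have hlen : C.length ≤ m := hm.2 C (prim_of_nodup hne hC hndt)
  have hpos : 0 < C.length := List.length_pos_iff.2 hne
  have hbC := closed_bal hC
  have cnt1 : ∀ a, (C : Multiset Q.A).count a = if a ∈ C then 1 else 0 := by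
    intro a
    rw [Multiset.coe_count]
    split_ifs with h
    · exact List.count_eq_one_of_mem hnd h
    · exact List.count_eq_zero.2 h
  by_cases h2 : ∀ c ∈ C, 2 ≤ s.count c
  · obtain ⟨b, hb, c, hc, hbc, hb2, hc2⟩ := hg w C hne hC hnd
      (fun c hc => (h2 c hc).trans (Multiset.count_le_of_le c hsg))
    have hle : (C : Multiset Q.A) + C ≤ s := by
      rw [Multiset.le_iff_count]
      intro a
      rw [Multiset.count_add, cnt1]
      split_ifs with h
      · exact h2 a h
      · simp
    obtain ⟨t, rfl⟩ := Multiset.le_iff_exists_add.1 hle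
    have ht : Bal t := by
      unfold Bal at hs hbC ⊢
      simp only [Multiset.map_add, hbC] at hs
      exact add_left_cancel hs
    have hcard : t.card + 2 * C.length = k := by
      rw [← hk]; simp; omega
    have h1 := ih t.card (by omega) t rfl ((Multiset.le_add_left _ _).trans hsg) ht
    have hbt : b ∉ t := by
      have := Multiset.count_le_of_le b hsg
      simp only [Multiset.count_add, cnt1, hb, if_true] at this
      exact Multiset.count_eq_zero.1 (by omega)
    have hct : c ∉ t := by
      have := Multiset.count_le_of_le c hsg
      simp only [Multiset.count_add, cnt1, hc, if_true] at this
      exact Multiset.count_eq_zero.1 (by omega)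
    have hsub : insert b (insert c t.toFinset) ⊆ ((C : Multiset Q.A) + C + t).toFinset := by
      intro a ha
      simp at ha ⊢
      rcases ha with rfl | rfl | ha <;> tauto
    have hle2 := Finset.card_le_card hsub
    rw [Finset.card_insert_of_notMem (by simp [hbc, hbt]),
      Finset.card_insert_of_notMem (by simp [hct])] at hle2
    have := Nat.mul_le_mul_left m hle2
    rw [hk]
    nlinarith
  · push Not at h2
    obtain ⟨b, hb, hb2⟩ := h2
    have hle : (C : Multiset Q.A) ≤ s := by
      rw [Multiset.le_iff_count]
      intro a
      rw [cnt1]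
      split_ifs with h
      · exact Multiset.count_pos.2 (hmem a h)
      · simp
    obtain ⟨t, rfl⟩ := Multiset.le_iff_exists_add.1 hle
    have ht : Bal t := by
      unfold Bal at hs hbC ⊢
      simp only [Multiset.map_add, hbC] at hs
      exact add_left_cancel hs
    have hcard : t.card + C.length = k := by
      rw [← hk]; simp; omega
    have h1 := ih t.card (by omega) t rfl ((Multiset.le_add_left _ _).trans hsg) ht
    have hbt : b ∉ t := by
      simp only [Multiset.count_add, cnt1, hb, if_true] at hb2
      exact Multiset.count_eq_zero.1 (by omega)
    have hsub : insert b t.toFinset ⊆ ((C : Multiset Q.A) + t).toFinset := by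
      intro a ha
      simp at ha ⊢
      rcases ha with rfl | ha <;> tauto
    have hle2 := Finset.card_le_card hsub
    rw [Finset.card_insert_of_notMem (by simp [hbt])] at hle2
    have := Nat.mul_le_mul_left m hle2
    rw [hk]
    nlinarith

end QuiverData

/-- **Corollary (upper bound on paths, char 2).** Let `char K = 2` and let `Q` be a
quiver with `d` arrows whose maximal degree of primitive closed paths is `m`.
If `h` is a closed path in `Q` with `h ≢ 0`, then `deg h ≤ m·d`. -/
theorem length_le_of_not_equiv_zero_char_two
    (K : Type) [Field K] [Infinite K] (hchar : ringChar K = 2)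
    (Q : QuiverData) [Fintype Q.A] (d m : ℕ)
    (hd : Fintype.card Q.A = d) (hm : Q.MaxPrimDeg m)
    (w₀ : Q.V) (h : List Q.A) (hcl : Q.IsClosedAt w₀ h)
    (h0 : ¬ Q.EquivZero (ringChar K = 2) h) :
    h.length ≤ m * d := by
  have key := QuiverData.card_bound hm (g := (h : Multiset Q.A)) (by
    intro u C hne hC hnd h2
    simp only [Multiset.coe_count] at h2 ⊢
    exact QuiverData.two_small hchar hcl.2 h0 hne hC hnd h2) _ (h : Multiset Q.A) rfl le_rfl
    (QuiverData.closed_bal hcl.2)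
  rw [Multiset.coe_card] at key
  refine key.trans (Nat.mul_le_mul_left m ?_)
  rw [← hd]
  exact Finset.card_le_univ _
end

section
/- Let K be an infinite field and let n ≥ m ≥ 2 be integers. Then for all sufficiently large d there exist a strongly connected quiver Q with n vertices, d arrows and m(Q) = m, and a closed path h in Q with h ≢ 0 (with respect to the equivalence ≡ on closed paths of Q), such that: (1) deg(h) = m·d − (2nm − m² − m) if char(K) = 2; (2) deg(h) = 3n if char(K) ≠ 2. -/
open Classical BigOperators

namespace QuiverData

theorem isPathFrom_append (Q : QuiverData) (l₁ l₂ : List Q.A) (u v : Q.V) :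
    Q.IsPathFrom u v (l₁ ++ l₂) ↔ ∃ w, Q.IsPathFrom u w l₁ ∧ Q.IsPathFrom w v l₂ := by
  induction l₁ generalizing u with
  | nil => simp [IsPathFrom]
  | cons a l ih => simp [IsPathFrom, ih, and_assoc]

theorem isPathFrom_range (Q : QuiverData) (f : ℕ → Q.A) (w : ℕ → Q.V) (k : ℕ)
    (h : ∀ i < k, Q.src (f i) = w i ∧ Q.tgt (f i) = w (i + 1)) :
    Q.IsPathFrom (w 0) (w k) ((List.range k).map f) := by
  induction k with
  | zero => simp [IsPathFrom]
  | succ k ih =>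
    rw [List.range_succ, List.map_append, isPathFrom_append]
    exact ⟨w k, ih fun i hi => h i (by omega), (h k (by omega)).1, (h k (by omega)).2⟩

/-- The predicate on signed closed paths with zero induced by a predicate on lists. -/
def liftPred (Q : QuiverData) (P : List Q.A → Prop) : Option (Bool × List Q.A) → Prop
  | none => False
  | some (_, l) => P l

theorem not_equivZero (Q : QuiverData) (c2 : Prop) (P : List Q.A → Prop)
    (hperm : ∀ l₁ l₂, l₁.Perm l₂ → P l₁ → P l₂)
    (hsq : ∀ v c d, Q.IsClosedAt v c → ¬ P (c ++ c ++ d))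
    (hfour : ¬ c2 → ∀ v c₁ c₂ c₃ c₄, Q.IsClosedAt v c₁ → Q.IsClosedAt v c₂ →
      Q.IsClosedAt v c₃ → Q.IsClosedAt v c₄ → ¬ P (c₁ ++ c₂ ++ c₃ ++ c₄))
    (l : List Q.A) (hl : P l) : ¬ Q.EquivZero c2 l := by
  have hp : ∀ l₁ l₂, l₁.Perm l₂ → (P l₁ ↔ P l₂) := fun l₁ l₂ h =>
    ⟨hperm _ _ h, hperm _ _ h.symm⟩
  have key : ∀ x y, Q.PEquiv c2 x y → (Q.liftPred P x ↔ Q.liftPred P y) := by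
    intro x y h
    induction h with
    | refl x => rfl
    | symm _ ih => exact ih.symm
    | trans _ _ ih₁ ih₂ => exact ih₁.trans ih₂
    | @neg x y _ ih =>
      have hn : ∀ z, Q.liftPred P (Q.negO z) ↔ Q.liftPred P z := by
        rintro (_ | ⟨e, l⟩) <;> rfl
      rw [hn, hn]; exact ih
    | cyc u v a b e _ _ _ => exact hp _ _ List.perm_append_comm
    | swap v w₁ c d w₂ e _ _ _ _ =>
      refine hp _ _ ?_
      simp only [List.append_assoc]
      refine List.Perm.append_left _ ?_
      rw [← List.append_assoc, ← List.append_assoc]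
      exact List.Perm.append_right _ List.perm_append_comm
    | sq_mul v c d e hc _ => exact iff_of_false (hsq v c d hc) id
    | sq v c e _ hc =>
      refine iff_of_false ?_ id
      have := hsq v c [] hc
      simpa [liftPred] using this
    | four v c₁ c₂ c₃ c₄ e hn h₁ h₂ h₃ h₄ =>
      exact iff_of_false (hfour hn v c₁ c₂ c₃ c₄ h₁ h₂ h₃ h₄) id
    | sign_triv e l _ => rfl
  intro h
  exact (key _ _ h).1 hl

theorem nodup_of_primitive (Q : QuiverData) (l : List Q.A)
    (h : ∀ a ∈ l, Q.vdeg l (Q.tgt a) = 1) : (l.map Q.tgt).Nodup := by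
  rw [List.nodup_iff_injective_get]
  intro i j hij
  have hi : i.1 < l.length := by simpa using i.2
  have hj : j.1 < l.length := by simpa using j.2
  have h1 := h (l.get ⟨i, hi⟩) (List.get_mem _ _)
  unfold vdeg at h1
  have hs := (Nat.card_eq_one_iff_unique.1 h1).1
  have hij' : Q.tgt (l.get ⟨i, hi⟩) = Q.tgt (l.get ⟨j, hj⟩) := by simpa using hij
  have := hs.elim ⟨⟨i, hi⟩, rfl⟩ ⟨⟨j, hj⟩, hij'.symm⟩
  ext
  simpa using this

theorem primitive_of_nodup (Q : QuiverData) (l : List Q.A)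
    (h : (l.map Q.tgt).Nodup) : ∀ a ∈ l, Q.vdeg l (Q.tgt a) = 1 := by
  intro a ha
  obtain ⟨i, rfl⟩ := List.get_of_mem ha
  unfold vdeg
  rw [Nat.card_eq_one_iff_unique]
  refine ⟨⟨?_⟩, ⟨⟨i, rfl⟩⟩⟩
  rintro ⟨x, hx⟩ ⟨y, hy⟩
  rw [List.nodup_iff_injective_get] at h
  have : (⟨x, by simp⟩ : Fin (l.map Q.tgt).length) = ⟨y, by simp⟩ := by
    apply h
    simpa using hx.trans hy.symm
  ext
  simpa using this

/-- Every primitive closed path of a cycle with a tail has degree at most `m`. -/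
theorem primitive_bound (n d m : ℕ) (hm : 2 ≤ m) (s t : Fin d → Fin n)
    (hR : ∀ a, (t a).1 = (s a).1 ∨ (t a).1 = (s a).1 + 1 ∨
      ((s a).1 = (t a).1 + 1 ∧ m ≤ (s a).1) ∨ ((s a).1 + 1 = m ∧ (t a).1 = 0))
    (l : List (Fin d)) (hl : (QuiverData.mk (Fin n) (Fin d) s t).IsPrimitive l) :
    l.length ≤ m := by
  obtain ⟨v, ⟨hne, hpath⟩, hprim⟩ := hl
  have hnd := nodup_of_primitive _ _ hprim
  change (l.map t).Nodup at hnd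
  obtain ⟨a, ha, hmax⟩ := l.toFinset.exists_max_image (fun b => (t b).1)
    (by simpa using hne)
  simp only [List.mem_toFinset] at ha hmax
  by_cases hk : (t a).1 < m
  · have h1 : (l.map (fun b => (t b).1)).Nodup := by
      have := hnd.map (f := Fin.val) Fin.val_injective
      simpa [List.map_map, Function.comp_def] using this
    have h2 : (l.map (fun b => (t b).1)) ⊆ List.range m := by
      intro x hx
      simp only [List.mem_map] at hx
      obtain ⟨b, hb, rfl⟩ := hx
      exact List.mem_range.2 ((hmax b hb).trans_lt hk)
    have := (h1.subperm h2).length_le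
    simpa using this
  · push Not at hk
    obtain ⟨p, q, rfl⟩ := List.append_of_mem ha
    rw [isPathFrom_append] at hpath
    obtain ⟨w, hp, hw, hq⟩ := hpath
    change s a = w at hw
    change (QuiverData.mk (Fin n) (Fin d) s t).IsPathFrom (t a) v q at hq
    have hy : (QuiverData.mk (Fin n) (Fin d) s t).IsPathFrom (t a) (s a) (q ++ p) := by
      rw [isPathFrom_append, hw]
      exact ⟨v, hq, hp⟩
    have hperm : (p ++ a :: q).Perm ((q ++ p) ++ [a]) :=
      List.perm_append_comm.trans (by
        simpa using (List.perm_append_comm : ([a] ++ (q ++ p)).Perm ((q ++ p) ++ [a])))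
    have hmax' : ∀ b ∈ q ++ p, (t b).1 ≤ (t a).1 := fun b hb =>
      hmax b (hperm.mem_iff.2 (List.mem_append_left _ hb))
    have hnd' := (hperm.map t).nodup_iff.1 hnd
    rw [hperm.length_eq]
    generalize q ++ p = y at hy hmax' hnd'
    rcases y with _ | ⟨b, y⟩
    · simp; omega
    obtain ⟨hb, hy⟩ := hy
    change s b = t a at hb
    change (QuiverData.mk (Fin n) (Fin d) s t).IsPathFrom (t b) (s a) y at hy
    simp only [List.map_append, List.map_cons, List.map_nil, List.cons_append,
      List.nodup_cons, List.mem_append, List.mem_map, List.mem_singleton, not_or] at hnd'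
    have hbm := hmax' b (by simp)
    have hba : (t b).1 ≠ (t a).1 := fun h => hnd'.1.2 (Fin.ext h)
    have hRb := hR b
    rw [hb] at hRb
    rcases List.eq_nil_or_concat y with rfl | ⟨z, c, rfl⟩
    · simp; omega
    exfalso
    rw [List.concat_eq_append] at hy hmax' hnd'
    rw [isPathFrom_append] at hy
    obtain ⟨u, _, _, hc⟩ := hy
    change t c = s a at hc
    have hcm := hmax' c (by simp)
    have hca : (t c).1 ≠ (t a).1 := by
      intro h
      have h2 := hnd'.2
      rw [List.nodup_append] at h2
      exact h2.2.2 (t c) (by simp) (t a) (by simp) (Fin.ext h)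
    have hcb : (t c).1 ≠ (t b).1 := fun h => hnd'.1.1 ⟨c, by simp, Fin.ext h⟩
    have hRa := hR a
    rw [← hc] at hRa
    omega

theorem maxPrim (n d m : ℕ) (hm : 2 ≤ m) (s t : Fin d → Fin n)
    (hR : ∀ a, (t a).1 = (s a).1 ∨ (t a).1 = (s a).1 + 1 ∨
      ((s a).1 = (t a).1 + 1 ∧ m ≤ (s a).1) ∨ ((s a).1 + 1 = m ∧ (t a).1 = 0))
    (f : ℕ → Fin d)
    (hf : ∀ i < m, (s (f i)).1 = i ∧ (t (f i)).1 = (i + 1) % m) :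
    (QuiverData.mk (Fin n) (Fin d) s t).MaxPrimDeg m := by
  refine ⟨⟨(List.range m).map f, ?_, by simp⟩, primitive_bound n d m hm s t hR⟩
  refine ⟨s (f 0), ⟨by simp; omega, ?_⟩, primitive_of_nodup _ _ ?_⟩
  · have := isPathFrom_range (QuiverData.mk (Fin n) (Fin d) s t) f
      (fun i => s (f (i % m))) m (by
        intro i hi
        refine ⟨by simp only [Nat.mod_eq_of_lt hi], Fin.ext ?_⟩
        change (t (f i)).1 = (s (f ((i + 1) % m))).1
        rw [(hf i hi).2, (hf _ (Nat.mod_lt _ (by omega))).1])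
    simpa using this
  · change (((List.range m).map f).map t).Nodup
    rw [List.map_map]
    refine List.Nodup.map_on ?_ List.nodup_range
    intro x hx y hy hxy
    rw [List.mem_range] at hx hy
    have h : (t (f x)).1 = (t (f y)).1 := congrArg Fin.val hxy
    rw [(hf x hx).2, (hf y hy).2] at h
    rcases Nat.lt_or_ge (x + 1) m with h1 | h1 <;> rcases Nat.lt_or_ge (y + 1) m with h2 | h2
    · rw [Nat.mod_eq_of_lt h1, Nat.mod_eq_of_lt h2] at h; omega
    · rw [Nat.mod_eq_of_lt h1, show y + 1 = m by omega, Nat.mod_self] at h; omega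
    · rw [Nat.mod_eq_of_lt h2, show x + 1 = m by omega, Nat.mod_self] at h; omega
    · omega

end QuiverData

/-- Sources in the example for characteristic 2. -/
def srcTwo (n m j : ℕ) : ℕ :=
  if j + 1 ≤ n then j else if j + m < 2 * n then 2 * (n - 1) - j else m - 1

/-- Targets in the example for characteristic 2. -/
def tgtTwo (n m j : ℕ) : ℕ :=
  if j + m + 1 < 2 * n then srcTwo n m (j + 1) else 0

/-- The sequence of vertices of the long path in the example for characteristic not 2. -/
def seqOdd (n m j : ℕ) : ℕ :=
  if j < 3 * (m - 1) then j / 3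
  else if j < 2 * n + m - 1 then m - 1 + (j - 3 * (m - 1)) / 2
  else if j < 3 * n then 3 * n + m - 2 - j else 0

/-- Targets in the example for characteristic not 2. -/
def tgtOdd (n m j : ℕ) : ℕ :=
  if j < 3 * n then seqOdd n m (j + 1) else 0

theorem srcTwo_lt (n m j : ℕ) (hm : 2 ≤ m) (hmn : m ≤ n) : srcTwo n m j < n := by
  unfold srcTwo; split_ifs <;> omega

theorem tgtTwo_lt (n m j : ℕ) (hm : 2 ≤ m) (hmn : m ≤ n) : tgtTwo n m j < n := by
  unfold tgtTwo; split_ifs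
  · exact srcTwo_lt n m _ hm hmn
  · omega

theorem seqOdd_lt (n m j : ℕ) (hm : 2 ≤ m) (hmn : m ≤ n) : seqOdd n m j < n := by
  unfold seqOdd; split_ifs <;> omega

theorem tgtOdd_lt (n m j : ℕ) (hm : 2 ≤ m) (hmn : m ≤ n) : tgtOdd n m j < n := by
  unfold tgtOdd; split_ifs
  · exact seqOdd_lt n m _ hm hmn
  · omega

/-- The example in characteristic 2. -/
theorem example_two (n m d : ℕ) (hm : 2 ≤ m) (hmn : m ≤ n) (hd : 3 * n ≤ d) (c2 : Prop)
    (hc2 : c2) :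
    ∃ s t : Fin d → Fin n,
        (QuiverData.mk (Fin n) (Fin d) s t).StronglyConnected ∧
        (QuiverData.mk (Fin n) (Fin d) s t).MaxPrimDeg m ∧
        ∃ (v : Fin n) (h : List (Fin d)),
          (QuiverData.mk (Fin n) (Fin d) s t).IsClosedAt v h ∧
          ¬ (QuiverData.mk (Fin n) (Fin d) s t).EquivZero c2 h ∧
          h.length + 2 * n * m = m * d + m ^ 2 + m := by
  have hd0 : 0 < d := by omega
  have hn0 : 0 < n := by omega
  let s : Fin d → Fin n := fun j => ⟨srcTwo n m j.1, srcTwo_lt n m _ hm hmn⟩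
  let t : Fin d → Fin n := fun j => ⟨tgtTwo n m j.1, tgtTwo_lt n m _ hm hmn⟩
  let g : ℕ → Fin d := fun i => if h : i < d then ⟨i, h⟩ else ⟨0, hd0⟩
  have hg : ∀ i, i < d → (g i).1 = i := fun i hi => by simp [g, hi]
  refine ⟨s, t, Or.inl ?_, ?_, ?_⟩
  · refine ⟨⟨0, hn0⟩, (List.range (2 * n - m)).map g, ⟨by simp; omega, ?_⟩, ?_⟩
    · have := QuiverData.isPathFrom_range (QuiverData.mk (Fin n) (Fin d) s t) g
        (fun i => if i < 2 * n - m then s (g i) else ⟨0, hn0⟩) (2 * n - m) (by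
          intro i hi
          refine ⟨by simp [hi], Fin.ext ?_⟩
          change tgtTwo n m (g i).1 = _
          rw [hg i (by omega)]
          unfold tgtTwo
          by_cases h : i + m + 1 < 2 * n
          · have h' : i + 1 < 2 * n - m := by omega
            simp only [h, h', if_true]
            change _ = srcTwo n m (g (i + 1)).1
            rw [hg _ (by omega)]
          · have h' : ¬ (i + 1 < 2 * n - m) := by omega
            simp only [h, h', if_false])
      have h0 : (0 : ℕ) < 2 * n - m := by omega
      simp only [h0, if_true, lt_irrefl, if_false] at this
      convert this using 1
      apply Fin.ext
      change 0 = srcTwo n m (g 0).1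
      rw [hg 0 hd0]
      simp [srcTwo]
      omega
    · intro w
      have hw := w.2
      rcases Nat.eq_zero_or_pos w.1 with h0 | h0
      · refine ⟨g (2 * n - m - 1), List.mem_map_of_mem (List.mem_range.2 (by omega)), Fin.ext ?_⟩
        change tgtTwo n m (g _).1 = _
        rw [hg _ (by omega)]
        unfold tgtTwo
        rw [if_neg (by omega), h0]
      · refine ⟨g (w.1 - 1), List.mem_map_of_mem (List.mem_range.2 (by omega)), Fin.ext ?_⟩
        change tgtTwo n m (g _).1 = _
        rw [hg _ (by omega)]
        unfold tgtTwo srcTwo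
        split_ifs <;> omega
  · refine QuiverData.maxPrim n d m hm s t ?_ (fun i => if i + 1 < m then g i else g (2 * n - m - 1)) ?_
    · intro a
      simp only [s, t]
      unfold tgtTwo srcTwo
      split_ifs <;> omega
    · intro i hi
      simp only [s, t]
      by_cases h : i + 1 < m
      · rw [if_pos h, hg _ (by omega), Nat.mod_eq_of_lt h]
        unfold tgtTwo srcTwo
        split_ifs <;> omega
      · rw [if_neg h, hg _ (by omega), show i + 1 = m by omega, Nat.mod_self]
        unfold tgtTwo srcTwo
        split_ifs <;> omega
  · obtain ⟨k, hk⟩ : ∃ k, d + m + 1 = k + 2 * n := ⟨d + m + 1 - 2 * n, by omega⟩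
    let f : ℕ → Fin d := fun i => if i % m + 1 < m then g (i % m) else g (2 * n - m - 1 + i / m)
    have hdiv : ∀ i, i < m * k → i / m < k := fun i hi => Nat.div_lt_of_lt_mul hi
    have hfv : ∀ i, i < m * k →
        (f i).1 = if i % m + 1 < m then i % m else 2 * n - m - 1 + i / m := by
      intro i hi
      have := hdiv i hi
      simp only [f]
      split_ifs
      · exact hg _ (by omega)
      · exact hg _ (by omega)
    have hk0 : 0 < k := by omega
    refine ⟨⟨0, hn0⟩, (List.range (m * k)).map f, ⟨?_, ?_⟩, ?_, ?_⟩
    · have : 0 < m * k := Nat.mul_pos (by omega) hk0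
      simp only [ne_eq, List.map_eq_nil_iff, List.range_eq_nil]
      omega
    · have := QuiverData.isPathFrom_range (QuiverData.mk (Fin n) (Fin d) s t) f
        (fun i => ⟨i % m, (Nat.mod_lt i (by omega)).trans_le hmn⟩) (m * k) (by
          intro i hi
          have hlt := Nat.mod_lt i (show 0 < m by omega)
          have hadd : (i + 1) % m = if i % m + 1 < m then i % m + 1 else 0 := by
            rw [Nat.add_mod, Nat.mod_eq_of_lt (show 1 < m by omega)]
            split_ifs with h
            · exact Nat.mod_eq_of_lt h
            · rw [show i % m + 1 = m by omega, Nat.mod_self]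
          refine ⟨Fin.ext ?_, Fin.ext ?_⟩
          · change srcTwo n m (f i).1 = i % m
            rw [hfv i hi]
            clear hfv hadd hdiv
            generalize i % m = x at *
            generalize i / m = y at *
            unfold srcTwo
            split_ifs <;> omega
          · change tgtTwo n m (f i).1 = (i + 1) % m
            rw [hfv i hi, hadd]
            clear hfv hadd hdiv
            generalize i % m = x at *
            generalize i / m = y at *
            unfold tgtTwo srcTwo
            split_ifs <;> omega)
      simpa using this
    · refine QuiverData.not_equivZero _ c2
        (fun l : List (Fin d) => l.Pairwise (fun x y : Fin d => x = y → x.1 < m - 1) ∧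
          ∀ x ∈ l, x.1 < m - 1 ∨ 2 * n - m - 1 ≤ x.1) ?_ ?_ (fun h => absurd hc2 h) _ ?_
      · rintro l₁ l₂ hp ⟨h1, h2⟩
        refine ⟨(hp.pairwise_iff ?_).1 h1, fun x hx => h2 x (hp.mem_iff.2 hx)⟩
        intro x y h hxy
        exact hxy ▸ h hxy.symm
      · rintro v c e ⟨hc0, hc⟩ ⟨h1, _⟩
        rw [List.append_assoc] at h1
        have hsmall : ∀ x ∈ c, x.1 < m - 1 := fun x hx =>
          (List.pairwise_append.1 h1).2.2 x hx x (List.mem_append_left _ hx) rfl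
        have hmono : ∀ (c : List (Fin d)) (u v : Fin n), (∀ x ∈ c, x.1 < m - 1) →
            (QuiverData.mk (Fin n) (Fin d) s t).IsPathFrom u v c → v.1 = u.1 + c.length := by
          intro c
          induction c with
          | nil =>
            intro u v _ h
            have h : u = v := h
            simp [h]
          | cons x c ih =>
            intro u v hx hp
            have h1 : s x = u := hp.1
            have h2 := ih (t x) v (fun y hy => hx y (List.mem_cons_of_mem _ hy)) hp.2
            have h3 := hx x (by simp)
            have h4 : (t x).1 = (s x).1 + 1 := by
              simp only [s, t]
              unfold tgtTwo srcTwo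
              split_ifs <;> omega
            rw [List.length_cons, ← h1]
            omega
        have := hmono c v v hsmall hc
        exact hc0 (List.length_eq_zero_iff.1 (by omega))
      · constructor
        · rw [List.pairwise_map]
          refine List.Pairwise.imp_of_mem ?_ (List.pairwise_lt_range)
          intro x y hx hy hxy h
          rw [List.mem_range] at hx hy
          have h' : (f x).1 = (f y).1 := congrArg Fin.val h
          rw [hfv x hx]
          rw [hfv x hx, hfv y hy] at h'
          have e1 := Nat.div_add_mod x m
          have e2 := Nat.div_add_mod y m
          have l1 := Nat.mod_lt x (show 0 < m by omega)
          have l2 := Nat.mod_lt y (show 0 < m by omega)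
          by_cases h1 : x % m + 1 < m
          · rw [if_pos h1]; omega
          · exfalso
            rw [if_neg h1] at h'
            by_cases h2 : y % m + 1 < m
            · rw [if_pos h2] at h'
              clear e1 e2
              generalize x / m = z at *
              omega
            · rw [if_neg h2] at h'
              have h3 : x / m = y / m := by omega
              rw [h3] at e1
              omega
        · intro x hx
          rw [List.mem_map] at hx
          obtain ⟨i, hi, rfl⟩ := hx
          rw [List.mem_range] at hi
          rw [hfv i hi]
          generalize i % m = x
          generalize i / m = y
          split_ifs <;> omega
    · rw [List.length_map, List.length_range]
      have : m * (d + m + 1) = m * (k + 2 * n) := by rw [hk]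
      nlinarith

/-- The example in characteristic different from 2. -/
theorem example_odd (n m d : ℕ) (hm : 2 ≤ m) (hmn : m ≤ n) (hd : 3 * n ≤ d) (c2 : Prop) :
    ∃ s t : Fin d → Fin n,
        (QuiverData.mk (Fin n) (Fin d) s t).StronglyConnected ∧
        (QuiverData.mk (Fin n) (Fin d) s t).MaxPrimDeg m ∧
        ∃ (v : Fin n) (h : List (Fin d)),
          (QuiverData.mk (Fin n) (Fin d) s t).IsClosedAt v h ∧
          ¬ (QuiverData.mk (Fin n) (Fin d) s t).EquivZero c2 h ∧
          h.length = 3 * n := by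
  have hd0 : 0 < d := by omega
  have hn0 : 0 < n := by omega
  let s : Fin d → Fin n := fun j => ⟨seqOdd n m j.1, seqOdd_lt n m _ hm hmn⟩
  let t : Fin d → Fin n := fun j => ⟨tgtOdd n m j.1, tgtOdd_lt n m _ hm hmn⟩
  let g : ℕ → Fin d := fun i => if h : i < d then ⟨i, h⟩ else ⟨0, hd0⟩
  have hg : ∀ i, i < d → (g i).1 = i := fun i hi => by simp [g, hi]
  have hclosed : (QuiverData.mk (Fin n) (Fin d) s t).IsClosedAt ⟨0, hn0⟩
      ((List.range (3 * n)).map g) := by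
    refine ⟨by simp; omega, ?_⟩
    have := QuiverData.isPathFrom_range (QuiverData.mk (Fin n) (Fin d) s t) g
      (fun i => ⟨seqOdd n m i, seqOdd_lt n m _ hm hmn⟩) (3 * n) (by
        intro i hi
        refine ⟨Fin.ext ?_, Fin.ext ?_⟩
        · change seqOdd n m (g i).1 = seqOdd n m i
          rw [hg i (by omega)]
        · change tgtOdd n m (g i).1 = seqOdd n m (i + 1)
          rw [hg i (by omega), tgtOdd, if_pos hi])
    convert this using 1
    · apply Fin.ext
      change 0 = seqOdd n m 0
      unfold seqOdd
      split_ifs <;> omega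
    · apply Fin.ext
      change 0 = seqOdd n m (3 * n)
      unfold seqOdd
      split_ifs <;> omega
  refine ⟨s, t, Or.inl ⟨_, _, hclosed, ?_⟩, ?_, _, _, hclosed, ?_, by simp⟩
  · intro w
    have hw := w.2
    have hmem : ∀ i, i < 3 * n → tgtOdd n m i = w.1 →
        ∃ a ∈ (List.range (3 * n)).map g, t a = w := by
      intro i hi h
      refine ⟨g i, List.mem_map_of_mem (List.mem_range.2 hi), Fin.ext ?_⟩
      change tgtOdd n m (g i).1 = _
      rw [hg i (by omega), h]
    rcases Nat.lt_or_ge w.1 (m - 1) with h | h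
    · apply hmem (3 * w.1 + 1) (by omega)
      unfold tgtOdd seqOdd
      split_ifs <;> omega
    · apply hmem (3 * n + m - 3 - w.1) (by omega)
      unfold tgtOdd seqOdd
      split_ifs <;> omega
  · refine QuiverData.maxPrim n d m hm s t ?_
      (fun i => if i + 1 < m then g (3 * i + 2) else g (3 * n - 1)) ?_
    · intro a
      simp only [s, t]
      unfold tgtOdd seqOdd
      split_ifs <;> omega
    · intro i hi
      simp only [s, t]
      by_cases h : i + 1 < m
      · rw [if_pos h, hg _ (by omega), Nat.mod_eq_of_lt h]
        unfold tgtOdd seqOdd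
        split_ifs <;> omega
      · rw [if_neg h, hg _ (by omega), show i + 1 = m by omega, Nat.mod_self]
        unfold tgtOdd seqOdd
        split_ifs <;> omega
  · refine QuiverData.not_equivZero _ c2
      (fun l : List (Fin d) => l.Nodup ∧ ∀ x ∈ l, x.1 < 3 * n) ?_ ?_ ?_ _ ?_
    · rintro l₁ l₂ hp ⟨h1, h2⟩
      exact ⟨hp.nodup_iff.1 h1, fun x hx => h2 x (hp.mem_iff.2 hx)⟩
    · rintro v c e ⟨hc0, _⟩ ⟨h1, _⟩
      obtain ⟨x, hx⟩ := List.exists_mem_of_ne_nil c hc0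
      rw [List.append_assoc, List.nodup_append] at h1
      exact h1.2.2 x hx x (List.mem_append_left _ hx) rfl
    · rintro _ v c₁ c₂ c₃ c₄ h₁ h₂ h₃ h₄ ⟨hnd, hlt⟩
      have hhead : ∀ c : List (Fin d),
          (QuiverData.mk (Fin n) (Fin d) s t).IsClosedAt v c →
          ∃ x ∈ c, seqOdd n m x.1 = v.1 := by
        rintro (_ | ⟨x, c⟩) ⟨h0, hp⟩
        · exact absurd rfl h0
        · refine ⟨x, by simp, ?_⟩
          have h : s x = v := hp.1
          exact congrArg Fin.val h
      obtain ⟨x₁, m₁, e₁⟩ := hhead c₁ h₁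
      obtain ⟨x₂, m₂, e₂⟩ := hhead c₂ h₂
      obtain ⟨x₃, m₃, e₃⟩ := hhead c₃ h₃
      obtain ⟨x₄, m₄, e₄⟩ := hhead c₄ h₄
      have l₁ := hlt x₁ (by simp [m₁])
      have l₂ := hlt x₂ (by simp [m₂])
      have l₃ := hlt x₃ (by simp [m₃])
      have l₄ := hlt x₄ (by simp [m₄])
      rw [List.nodup_append, List.nodup_append, List.nodup_append] at hnd
      obtain ⟨⟨⟨_, _, d12⟩, _, d3⟩, _, d4⟩ := hnd
      have n12 : x₁.1 ≠ x₂.1 := fun h => d12 x₁ m₁ x₂ m₂ (Fin.ext h)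
      have n13 : x₁.1 ≠ x₃.1 := fun h => d3 x₁ (by simp [m₁]) x₃ m₃ (Fin.ext h)
      have n23 : x₂.1 ≠ x₃.1 := fun h => d3 x₂ (by simp [m₂]) x₃ m₃ (Fin.ext h)
      have n14 : x₁.1 ≠ x₄.1 := fun h => d4 x₁ (by simp [m₁]) x₄ m₄ (Fin.ext h)
      have n24 : x₂.1 ≠ x₄.1 := fun h => d4 x₂ (by simp [m₂]) x₄ m₄ (Fin.ext h)
      have n34 : x₃.1 ≠ x₄.1 := fun h => d4 x₃ (by simp [m₃]) x₄ m₄ (Fin.ext h)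
      have hcases : ∃ p q r : ℕ, ∀ x, x < 3 * n → seqOdd n m x = v.1 →
          x = p ∨ x = q ∨ x = r := by
        rcases Nat.lt_or_ge v.1 (m - 1) with h | h
        · refine ⟨3 * v.1, 3 * v.1 + 1, 3 * v.1 + 2, ?_⟩
          intro x hx
          unfold seqOdd
          split_ifs <;> omega
        · refine ⟨3 * (m - 1) + 2 * (v.1 - (m - 1)), 3 * (m - 1) + 2 * (v.1 - (m - 1)) + 1,
            3 * n + m - 2 - v.1, ?_⟩
          intro x hx
          unfold seqOdd
          split_ifs <;> omega
      obtain ⟨p, q, r, hpqr⟩ := hcases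
      have y₁ := hpqr _ l₁ e₁
      have y₂ := hpqr _ l₂ e₂
      have y₃ := hpqr _ l₃ e₃
      have y₄ := hpqr _ l₄ e₄
      clear e₁ e₂ e₃ e₄ hpqr l₁ l₂ l₃ l₄
      omega
    · constructor
      · refine List.Nodup.map_on ?_ List.nodup_range
        intro x hx y hy h
        rw [List.mem_range] at hx hy
        have := congrArg Fin.val h
        rwa [hg x (by omega), hg y (by omega)] at this
      · intro x hx
        rw [List.mem_map] at hx
        obtain ⟨i, hi, rfl⟩ := hx
        rw [List.mem_range] at hi
        rw [hg i (by omega)]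
        exact hi

/-- **Lemma (examples).** Let `K` be an infinite field and `n ≥ m ≥ 2`.  Then for all
sufficiently large `d` there are a strongly connected quiver `Q` with `n` vertices,
`d` arrows and `m(Q) = m`, and a closed path `h` in `Q` with `h ≢ 0`, such that:
(1) `deg h = m·d − (2nm − m² − m)` if `char K = 2` (stated additively as
`deg h + 2nm = md + m² + m`); and (2) `deg h = 3n` if `char K ≠ 2`. -/
theorem examples_exist
    (K : Type) [Field K] [Infinite K] (n m : ℕ) (hm : 2 ≤ m) (hmn : m ≤ n) :
    ∃ d₀ : ℕ, ∀ d : ℕ, d₀ ≤ d →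
      ∃ s t : Fin d → Fin n,
        (QuiverData.mk (Fin n) (Fin d) s t).StronglyConnected ∧
        (QuiverData.mk (Fin n) (Fin d) s t).MaxPrimDeg m ∧
        ∃ (v : Fin n) (h : List (Fin d)),
          (QuiverData.mk (Fin n) (Fin d) s t).IsClosedAt v h ∧
          ¬ (QuiverData.mk (Fin n) (Fin d) s t).EquivZero (ringChar K = 2) h ∧
          (ringChar K = 2 → h.length + 2 * n * m = m * d + m ^ 2 + m) ∧
          (ringChar K ≠ 2 → h.length = 3 * n) := by
  refine ⟨3 * n, fun d hd => ?_⟩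
  by_cases hK : ringChar K = 2
  · obtain ⟨s, t, h1, h2, v, h, h3, h4, h5⟩ := example_two n m d hm hmn hd (ringChar K = 2) hK
    exact ⟨s, t, h1, h2, v, h, h3, h4, fun _ => h5, fun h' => absurd hK h'⟩
  · obtain ⟨s, t, h1, h2, v, h, h3, h4, h5⟩ := example_odd n m d hm hmn hd (ringChar K = 2)
    exact ⟨s, t, h1, h2, v, h, h3, h4, fun h' => absurd h' hK, fun _ => h5⟩
end
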